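/- arXiv:2009.00282 — 2 statements merged into one kernel-verified Lean document; each statement's English description precedes it below -/
import Mathlib

section
/- For every positive integer N there exist integers c, d, k, λ with c, d ≥ 2, a 2-(cd, k, λ) design 𝒟 = (𝒫,ℬ), and a block-transitive group G ≤ Aut(𝒟) leaving invariant a partition 𝒞 of 𝒫 with d classes each of size c, such that the Delandtsheer–Doyen parameters m, n (every block contains exactly n inner pairs and exactly mc outer pairs) satisfy m > N and n > N, and the induced groups H = G_C^C (on a class C) and K = G^𝒞 (on 𝒞) satisfy Rank(H) = 2n + 1 and Rank(K) = 2m + 1. -/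
open Finset

/-- Number of inner pairs of `B` with respect to the partition `𝒞`:
2-subsets of `B` contained in a single class of `𝒞`. -/
def innerPairs {P : Type*} [DecidableEq P] (𝒞 : Finset (Finset P)) (B : Finset P) : ℕ :=
  ((B.powersetCard 2).filter (fun p => ∃ C ∈ 𝒞, p ⊆ C)).card

/-- Number of outer pairs of `B` with respect to the partition `𝒞`:
2-subsets of `B` not contained in a single class of `𝒞`. -/
def outerPairs {P : Type*} [DecidableEq P] (𝒞 : Finset (Finset P)) (B : Finset P) : ℕ :=
  ((B.powersetCard 2).filter (fun p => ¬ ∃ C ∈ 𝒞, p ⊆ C)).card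

/-- The rank of a permutation group `X ≤ Sym(Ω)`: the number of `X`-orbits on `Ω × Ω`. -/
noncomputable def permRank {Ω : Type*} (X : Subgroup (Equiv.Perm Ω)) : ℕ :=
  Nat.card {O : Set (Ω × Ω) // ∃ p : Ω × Ω, O = {q | ∃ g ∈ X, (g p.1, g p.2) = q}}

/-- The pair-rank of a permutation group `X ≤ Sym(Ω)`: the number of `X`-orbits on
the 2-element subsets of `Ω`. -/
noncomputable def permPairRank {Ω : Type*} [DecidableEq Ω] (X : Subgroup (Equiv.Perm Ω)) : ℕ :=
  Nat.card {O : Set (Finset Ω) // ∃ s : Finset Ω, s.card = 2 ∧ O = {t | ∃ g ∈ X, s.image ⇑g = t}}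

theorem permRank_eq_card_of_regular {Ω : Type*} [Nonempty Ω] (X : Subgroup (Equiv.Perm Ω))
    (htrans : ∀ x y, ∃ g ∈ X, g x = y) (hsemi : ∀ g ∈ X, ∀ x, g x = x → g = 1) :
    permRank X = Nat.card Ω := by
  obtain ⟨x₀⟩ := ‹Nonempty Ω›
  symm
  refine Nat.card_congr (Equiv.ofBijective
    (fun y => ⟨{q | ∃ g ∈ X, (g x₀, g y) = q}, (x₀, y), rfl⟩) ⟨fun y z hyz => ?_, ?_⟩)
  · have hset : {q | ∃ g ∈ X, (g x₀, g y) = q} = {q | ∃ g ∈ X, (g x₀, g z) = q} :=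
      congrArg Subtype.val hyz
    have hmem : (x₀, y) ∈ {q | ∃ g ∈ X, (g x₀, g z) = q} := hset ▸ ⟨1, X.one_mem, rfl⟩
    obtain ⟨g, hg, hgq⟩ := hmem
    rw [Prod.mk.injEq] at hgq
    have := hsemi g hg x₀ hgq.1
    simpa [this] using hgq.2.symm
  · rintro ⟨_, ⟨x, y⟩, rfl⟩
    obtain ⟨g, hg, rfl⟩ := htrans x₀ x
    refine ⟨g⁻¹ y, Subtype.ext (Set.ext fun q => ⟨?_, ?_⟩)⟩
    · rintro ⟨k, hk, rfl⟩
      exact ⟨k * g⁻¹, X.mul_mem hk (X.inv_mem hg), by simp⟩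
    · rintro ⟨k, hk, rfl⟩
      exact ⟨k * g, X.mul_mem hk hg, by simp⟩

theorem card_filter_offDiag {P : Type*} [DecidableEq P] (B : Finset P) (Q : Finset P → Prop)
    [DecidablePred Q] :
    (B.offDiag.filter fun p => Q {p.1, p.2}).card
      = 2 * ((B.powersetCard 2).filter Q).card := by
  rw [card_eq_sum_card_fiberwise (f := fun p : P × P => ({p.1, p.2} : Finset P))
    (t := (B.powersetCard 2).filter Q), sum_const_nat (m := 2), mul_comm]
  · intro s hs
    rw [mem_filter, mem_powersetCard] at hs
    obtain ⟨⟨hsB, hs2⟩, hsQ⟩ := hs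
    obtain ⟨x, y, hxy, rfl⟩ := card_eq_two.1 hs2
    have hx : x ∈ B := hsB (by simp)
    have hy : y ∈ B := hsB (by simp)
    rw [card_eq_two]
    refine ⟨(x, y), (y, x), by simp [hxy], ?_⟩
    ext ⟨u, w⟩
    simp only [mem_filter, mem_offDiag, mem_insert, mem_singleton, Prod.mk.injEq]
    constructor
    · rintro ⟨⟨⟨_, _, huw⟩, _⟩, he⟩
      have hu : u ∈ ({x, y} : Finset P) := he ▸ (by simp)
      have hw : w ∈ ({x, y} : Finset P) := he ▸ (by simp)
      simp only [mem_insert, mem_singleton] at hu hw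
      grind
    · rintro (⟨rfl, rfl⟩ | ⟨rfl, rfl⟩)
      · exact ⟨⟨⟨hx, hy, hxy⟩, hsQ⟩, rfl⟩
      · exact ⟨⟨⟨hy, hx, hxy.symm⟩, by rwa [pair_comm]⟩, pair_comm _ _⟩
  · rintro ⟨x, y⟩ h
    simp only [coe_filter, Set.mem_ofPred_eq, mem_offDiag, mem_powersetCard] at h ⊢
    refine ⟨⟨?_, card_pair h.1.2.2⟩, h.2⟩
    simp [insert_subset_iff, h.1.1, h.1.2.1]

/-- A perfect difference set in a finite abelian group: each nonidentity element is a quotient of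
two members of `S` in exactly one way. -/
def IsPerfectDifferenceSet {A : Type*} [Group A] (S : Set A) : Prop :=
  ∀ a : A, a ≠ 1 → ∃! p : A × A, p.1 ∈ S ∧ p.2 ∈ S ∧ p.1 / p.2 = a

theorem IsPerfectDifferenceSet.image {A B : Type*} [Group A] [Group B] {S : Set A}
    (hS : IsPerfectDifferenceSet S) (e : A ≃* B) : IsPerfectDifferenceSet (e '' S) := by
  intro b hb
  obtain ⟨⟨s, t⟩, ⟨hs, ht, hst⟩, huniq⟩ := hS (e.symm b) (by simpa using hb)
  refine ⟨(e s, e t), ⟨⟨s, hs, rfl⟩, ⟨t, ht, rfl⟩, ?_⟩, ?_⟩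
  · simpa using congrArg e hst
  · rintro ⟨_, _⟩ ⟨⟨u, hu, rfl⟩, ⟨w, hw, rfl⟩, huw⟩
    have := huniq (u, w) ⟨hu, hw, by rw [← huw]; simp⟩
    simp_all

theorem IsPerfectDifferenceSet.card_filter_offDiag
    {P : Type*} [CommGroup P] [Fintype P] [DecidableEq P] {S : Finset P}
    (hS : IsPerfectDifferenceSet (S : Set P)) (a : P) (R : P → Prop) [DecidablePred R] :
    ((S.image (a * ·)).offDiag.filter fun p => R (p.1 / p.2)).card
      = (univ.filter fun x => x ≠ 1 ∧ R x).card := by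
  refine card_bij (fun p _ => p.1 / p.2) ?_ ?_ ?_
  · rintro ⟨x, y⟩ h
    simp only [mem_filter, mem_offDiag] at h
    simp only [mem_filter, mem_univ, true_and]
    exact ⟨div_ne_one.2 h.1.2.2, h.2⟩
  · rintro ⟨x, y⟩ h ⟨x', y'⟩ h' heq
    simp only [mem_filter, mem_offDiag, mem_image] at h h' heq
    obtain ⟨⟨⟨s, hs, rfl⟩, ⟨t, ht, rfl⟩, hne⟩, -⟩ := h
    obtain ⟨⟨⟨s', hs', rfl⟩, ⟨t', ht', rfl⟩, hne'⟩, -⟩ := h'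
    rw [mul_div_mul_left_eq_div, mul_div_mul_left_eq_div] at heq
    have := (hS (s / t) (fun h => hne (by rw [div_eq_one.1 h]))).unique
      (y₁ := (s, t)) (y₂ := (s', t')) ⟨hs, ht, rfl⟩ ⟨hs', ht', heq.symm⟩
    simp_all
  · intro b hb
    simp only [mem_filter, mem_univ, true_and] at hb
    obtain ⟨⟨s, t⟩, ⟨hs, ht, hst⟩, -⟩ := hS b hb.1
    refine ⟨(a * s, a * t), ?_, by simpa using hst⟩
    simp only [mem_filter, mem_offDiag, mem_image]
    refine ⟨⟨⟨s, hs, rfl⟩, ⟨t, ht, rfl⟩, ?_⟩, by simpa [hst] using hb.2⟩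
    intro h
    apply hb.1
    rw [← hst, mul_left_cancel h]
    exact div_self' t

theorem IsPerfectDifferenceSet.card_translates_containing
    {P : Type*} [CommGroup P] [Fintype P] [DecidableEq P] {S : Finset P}
    (hS : IsPerfectDifferenceSet (S : Set P)) {p : Finset P} (hp : p.card = 2) :
    ((univ.image fun a : P => S.image (a * ·)).filter fun B => p ⊆ B).card = 1 := by
  obtain ⟨x, y, hxy, rfl⟩ := card_eq_two.1 hp
  obtain ⟨⟨s, t⟩, ⟨hs, ht, hst⟩, huniq⟩ := hS (x / y) (div_ne_one.2 hxy)
  have hst' : x / s = y / t := by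
    rw [div_eq_div_iff_mul_eq_mul] at hst ⊢
    rw [← hst, mul_comm]
  rw [card_eq_one]
  refine ⟨S.image ((x / s) * ·), ?_⟩
  ext B
  simp only [mem_filter, mem_image, mem_univ, true_and, mem_singleton, insert_subset_iff,
    singleton_subset_iff]
  constructor
  · rintro ⟨⟨a, rfl⟩, hx, hy⟩
    simp only [mem_image] at hx hy
    obtain ⟨s', hs', rfl⟩ := hx
    obtain ⟨t', ht', rfl⟩ := hy
    have := huniq (s', t') ⟨hs', ht', by simp⟩
    rw [Prod.mk.injEq] at this
    rw [← this.1, mul_div_cancel_right]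
  · rintro rfl
    refine ⟨⟨_, rfl⟩, mem_image.2 ⟨s, hs, by simp⟩, mem_image.2 ⟨t, ht, ?_⟩⟩
    simp [hst']

/-- The coset of the subgroup `L` containing `a`, as a finset. -/
noncomputable def cosetFinset
    {P : Type*} [CommGroup P] [Fintype P] (L : Subgroup P) (a : P) : Finset P :=
  open Classical in univ.filter fun x => x / a ∈ L

theorem mem_cosetFinset
    {P : Type*} [CommGroup P] [Fintype P] {L : Subgroup P} {a x : P} :
    x ∈ cosetFinset L a ↔ x / a ∈ L := by
  simp [cosetFinset]

theorem cosetFinset_eq_iff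
    {P : Type*} [CommGroup P] [Fintype P] {L : Subgroup P} {a b : P} :
    cosetFinset L a = cosetFinset L b ↔ a / b ∈ L := by
  constructor
  · intro h
    rw [← mem_cosetFinset, ← h, mem_cosetFinset, div_self']
    exact L.one_mem
  · intro h
    ext x
    rw [mem_cosetFinset, mem_cosetFinset, ← div_mul_div_cancel x a b, L.mul_mem_cancel_right h]

theorem image_mul_cosetFinset
    {P : Type*} [CommGroup P] [Fintype P] [DecidableEq P] (L : Subgroup P) (g a : P) :
    (cosetFinset L a).image (g * ·) = cosetFinset L (g * a) := by
  ext x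
  simp only [mem_image, mem_cosetFinset]
  constructor
  · rintro ⟨y, hy, rfl⟩
    rwa [mul_div_mul_left_eq_div]
  · intro h
    exact ⟨x / g, by rwa [div_div], by simp⟩

theorem card_cosetFinset
    {P : Type*} [CommGroup P] [Fintype P] (L : Subgroup P) (a : P) :
    (cosetFinset L a).card = Nat.card L := by
  refine Eq.trans ?_ (Nat.card_eq_card_finite_toFinset (Set.toFinite (L : Set P))).symm
  refine card_bij (fun x _ => x / a) (fun x hx => ?_) (fun x _ y _ h => div_left_injective h)
    fun y hy => ⟨y * a, ?_, by simp⟩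
  · simpa using mem_cosetFinset.1 hx
  · simpa [mem_cosetFinset] using hy

theorem card_image_cosetFinset
    {P : Type*} [CommGroup P] [Fintype P] [DecidableEq P] (L : Subgroup P) :
    (univ.image (cosetFinset L)).card = L.index := by
  rw [Subgroup.index, ← Nat.card_eq_finsetCard]
  refine Nat.card_congr (Equiv.ofBijective (Quotient.lift
    (fun a => (⟨cosetFinset L a, mem_image_of_mem _ (mem_univ _)⟩ :
      univ.image (cosetFinset L))) ?_) ⟨?_, ?_⟩).symm
  · intro a b hab
    rw [Subtype.mk.injEq, cosetFinset_eq_iff, ← inv_mem_iff, inv_div, div_eq_inv_mul]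
    exact QuotientGroup.leftRel_apply.1 hab
  · intro x y
    induction x, y using Quotient.inductionOn₂ with | _ a b
    intro hab
    refine Quotient.sound (QuotientGroup.leftRel_apply.2 ?_)
    have := cosetFinset_eq_iff.1 (congrArg Subtype.val hab)
    rwa [← inv_mem_iff, inv_div, div_eq_inv_mul] at this
  · rintro ⟨_, hD⟩
    obtain ⟨a, -, rfl⟩ := mem_image.1 hD
    exact ⟨Quotient.mk'' a, rfl⟩

/-- A pair lies in a common coset of `L` exactly when its quotient is in `L`. -/
theorem exists_pair_subset_coset_iff
    {P : Type*} [CommGroup P] [Fintype P] [DecidableEq P] {L : Subgroup P} {x y : P} :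
    (∃ C ∈ univ.image (cosetFinset L), ({x, y} : Finset P) ⊆ C) ↔ x / y ∈ L := by
  simp only [mem_image, mem_univ, true_and, exists_exists_eq_and, insert_subset_iff,
    singleton_subset_iff, mem_cosetFinset]
  constructor
  · rintro ⟨a, hx, hy⟩
    simpa using L.div_mem hx hy
  · intro h
    exact ⟨y, h, by simp⟩

theorem IsPerfectDifferenceSet.innerPairs_eq
    {P : Type*} [CommGroup P] [Fintype P] [DecidableEq P] {S : Finset P}
    (hS : IsPerfectDifferenceSet (S : Set P)) (L : Subgroup P) {n : ℕ}
    (hL : Nat.card L = 2 * n + 1) (a : P) :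
    innerPairs (univ.image (cosetFinset L)) (S.image (a * ·)) = n := by
  classical
  have h : (univ.filter fun x => x ≠ 1 ∧ x ∈ L).card
      = 2 * innerPairs (univ.image (cosetFinset L)) (S.image (a * ·)) := by
    unfold innerPairs
    rw [← hS.card_filter_offDiag a (· ∈ L), ← _root_.card_filter_offDiag]
    simp only [exists_pair_subset_coset_iff]
  have h2 : (univ.filter fun x => x ≠ 1 ∧ x ∈ L) = (cosetFinset L 1).erase 1 := by
    ext x; simp [mem_cosetFinset]
  rw [h2, card_erase_of_mem (by simp [mem_cosetFinset, L.one_mem]), card_cosetFinset, hL] at h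
  omega

theorem IsPerfectDifferenceSet.outerPairs_eq
    {P : Type*} [CommGroup P] [Fintype P] [DecidableEq P] {S : Finset P}
    (hS : IsPerfectDifferenceSet (S : Set P)) (L : Subgroup P) {m : ℕ}
    (hL : L.index = 2 * m + 1) (a : P) :
    outerPairs (univ.image (cosetFinset L)) (S.image (a * ·)) = m * Nat.card L := by
  classical
  have h : (univ.filter fun x => x ≠ 1 ∧ x ∉ L).card
      = 2 * outerPairs (univ.image (cosetFinset L)) (S.image (a * ·)) := by
    unfold outerPairs
    rw [← hS.card_filter_offDiag a (· ∉ L), ← _root_.card_filter_offDiag]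
    simp only [exists_pair_subset_coset_iff]
  have h2 : (univ.filter fun x => x ≠ 1 ∧ x ∉ L) = (cosetFinset L 1)ᶜ := by
    ext x
    simp only [mem_filter, mem_univ, true_and, mem_compl, mem_cosetFinset, div_one]
    exact ⟨fun h => h.2, fun h => ⟨fun h1 => h (h1 ▸ L.one_mem), h⟩⟩
  rw [h2, card_compl, card_cosetFinset, ← Nat.card_eq_fintype_card, ← L.card_mul_index, hL,
    mul_add, mul_one, Nat.add_sub_cancel, mul_left_comm, mul_comm _ m] at h
  omega

/-- The permutation group induced by translations on a coset of `L` is regular. -/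
theorem permRank_coset
    {P : Type*} [CommGroup P] [Fintype P] (L : Subgroup P) (a : P)
    (H : Subgroup (Equiv.Perm {x // x ∈ cosetFinset L a}))
    (hH : ∀ h : Equiv.Perm {x // x ∈ cosetFinset L a},
      h ∈ H ↔ ∃ g ∈ (MulAction.toPermHom P P).range, ∀ x, (↑(h x) : P) = g ↑x) :
    permRank H = Nat.card L := by
  have : Nonempty {x // x ∈ cosetFinset L a} := ⟨a, by simp [mem_cosetFinset, L.one_mem]⟩
  rw [permRank_eq_card_of_regular, ← card_cosetFinset L a]
  · simp
  · rintro ⟨x, hx⟩ ⟨y, hy⟩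
    have hyx : y / x ∈ L := by
      rw [mem_cosetFinset] at hx hy
      simpa using L.div_mem hy hx
    have hmem : ∀ z, (MulAction.toPermHom P P (y / x)) z ∈ cosetFinset L a ↔
        z ∈ cosetFinset L a := by
      intro z
      simp only [mem_cosetFinset, MulAction.toPermHom_apply, MulAction.toPerm_apply, smul_eq_mul]
      rw [mul_div_assoc, L.mul_mem_cancel_left hyx]
    refine ⟨(MulAction.toPermHom P P (y / x)).subtypePerm hmem,
      (hH _).2 ⟨_, ⟨_, rfl⟩, fun _ => rfl⟩, Subtype.ext ?_⟩
    simp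
  · intro h hh x hx
    obtain ⟨_, ⟨g, rfl⟩, hg⟩ := (hH h).1 hh
    have h1 : g = 1 := by
      have := hg x
      rw [hx] at this
      simpa using this
    ext z
    simp [hg z, h1]

/-- The permutation group induced by translations on the set of cosets of `L` is regular. -/
theorem permRank_cosets
    {P : Type*} [CommGroup P] [Fintype P] [DecidableEq P] (L : Subgroup P)
    (K : Subgroup (Equiv.Perm {D // D ∈ univ.image (cosetFinset L)}))
    (hK : ∀ κ : Equiv.Perm {D // D ∈ univ.image (cosetFinset L)},
      κ ∈ K ↔ ∃ g ∈ (MulAction.toPermHom P P).range, ∀ D,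
        (↑(κ D) : Finset P) = (↑D : Finset P).image ⇑g) :
    permRank K = L.index := by
  have : Nonempty {D // D ∈ univ.image (cosetFinset L)} :=
    ⟨cosetFinset L 1, mem_image_of_mem _ (mem_univ _)⟩
  have himg : ∀ g a : P, (cosetFinset L a).image ⇑(MulAction.toPermHom P P g)
      = cosetFinset L (g * a) := image_mul_cosetFinset L
  rw [permRank_eq_card_of_regular, ← card_image_cosetFinset L]
  · exact Nat.card_eq_finsetCard _
  · rintro ⟨D, hD⟩ ⟨E, hE⟩
    obtain ⟨a, -, rfl⟩ := mem_image.1 hD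
    obtain ⟨b, -, rfl⟩ := mem_image.1 hE
    have hmem : ∀ g : P, ∀ D ∈ univ.image (cosetFinset L),
        D.image ⇑(MulAction.toPermHom P P g) ∈ univ.image (cosetFinset L) := by
      intro g D hD
      obtain ⟨c, -, rfl⟩ := mem_image.1 hD
      rw [himg]
      exact mem_image_of_mem _ (mem_univ _)
    have hinv : ∀ g h : P, h * g = 1 → ∀ D : Finset P,
        (D.image ⇑(MulAction.toPermHom P P g)).image ⇑(MulAction.toPermHom P P h) = D := by
      intro g h hgh D
      rw [image_image]
      simp [Function.comp_def, ← mul_assoc, hgh]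
    refine ⟨⟨fun D => ⟨_, hmem (b / a) D D.2⟩, fun D => ⟨_, hmem (a / b) D D.2⟩,
      fun D => Subtype.ext (hinv _ _ (by simp) _), fun D => Subtype.ext (hinv _ _ (by simp) _)⟩,
      (hK _).2 ⟨_, ⟨b / a, rfl⟩, fun _ => rfl⟩, Subtype.ext ?_⟩
    exact (himg _ a).trans (by simp)
  · rintro κ hκ ⟨D, hD⟩ hfix
    obtain ⟨a, -, rfl⟩ := mem_image.1 hD
    obtain ⟨_, ⟨g, rfl⟩, hg⟩ := (hK κ).1 hκ
    have hgL : g ∈ L := by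
      have := hg ⟨cosetFinset L a, hD⟩
      rw [hfix, himg, eq_comm, cosetFinset_eq_iff] at this
      simpa using this
    refine Equiv.ext fun ⟨E, hE⟩ => Subtype.ext ?_
    obtain ⟨b, -, rfl⟩ := mem_image.1 hE
    rw [hg, himg, Equiv.Perm.one_apply, cosetFinset_eq_iff]
    simpa using hgL

theorem exists_submodule_finrank_eq_two {F K : Type*} [Field F] [AddCommGroup K] [Module F K]
    (h : Module.finrank F K = 3) : ∃ W : Submodule F K, Module.finrank F W = 2 := by
  have : Module.Finite F K := Module.finite_of_finrank_pos (by omega)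
  let b := Module.finBasisOfFinrankEq F K h
  refine ⟨Submodule.span F (Set.range (b ∘ (Fin.castSucc : Fin 2 → Fin 3))), ?_⟩
  rw [finrank_span_eq_card (b.linearIndependent.comp _ (Fin.castSucc_injective 2))]
  simp

/-- In a cubic field extension, a plane `W` meets its translate by an element outside the base
field in a line. -/
theorem exists_generator_inter_translate {F K : Type*} [Field F] [Field K] [Algebra F K]
    (h : Module.finrank F K = 3) {W : Submodule F K} (hW : Module.finrank F W = 2)
    {a : K} (ha : ∀ f : F, algebraMap F K f ≠ a) :
    ∃ v ≠ 0, v ∈ W ∧ a * v ∈ W ∧ ∀ w ∈ W, a * w ∈ W → ∃ f : F, f • v = w := by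
  have : Module.Finite F K := Module.finite_of_finrank_pos (by omega)
  have ha0 : a ≠ 0 := fun h0 => ha 0 (by simp [h0])
  let e : K ≃ₗ[F] K := DistribMulAction.toLinearEquiv F K (Units.mk0 a ha0)
  let U : Submodule F K := W.map (e.symm : K →ₗ[F] K)
  have hU : Module.finrank F U = 2 := (e.symm.finrank_map_eq W).trans hW
  have hmem : ∀ x, x ∈ U ↔ a * x ∈ W := fun x => Submodule.mem_map_equiv W
  have hstab : ¬ W ≤ U := by
    intro hle
    let T : Subalgebra F K :=
      { carrier := {x | ∀ w ∈ W, x * w ∈ W}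
        mul_mem' := fun {x y} hx hy w hw => by rw [mul_assoc]; exact hx _ (hy _ hw)
        add_mem' := fun {x y} hx hy w hw => by rw [add_mul]; exact W.add_mem (hx _ hw) (hy _ hw)
        algebraMap_mem' := fun r w hw => by
          rw [← Algebra.smul_def]; exact W.smul_mem r hw }
    have := Subalgebra.isSimpleOrder_of_finrank_prime F K (h ▸ Nat.prime_three)
    rcases eq_bot_or_eq_top T with hT | hT
    · have haT : a ∈ T := fun w hw => (hmem w).1 (hle hw)
      rw [hT, Algebra.mem_bot] at haT
      obtain ⟨f, hf⟩ := haT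
      exact ha f hf
    · obtain ⟨w, hw⟩ : ∃ w : W, w ≠ 0 := by
        have : Nontrivial W := Module.nontrivial_of_finrank_pos (R := F) (by omega)
        exact exists_ne 0
      have hw0 : (w : K) ≠ 0 := by simpa using hw
      have htop : W = ⊤ := by
        refine eq_top_iff.2 fun x _ => ?_
        have hx : x * (w : K)⁻¹ ∈ T := hT ▸ Algebra.mem_top
        simpa [mul_assoc, hw0] using hx w w.2
      rw [htop, finrank_top] at hW
      omega
  have hle : Module.finrank F (W ⊓ U : Submodule F K) = 1 := by
    have h1 := Submodule.finrank_sup_add_finrank_inf_eq W U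
    have h2 := Submodule.finrank_le (W ⊔ U)
    have h3 : Module.finrank F (W ⊓ U : Submodule F K) < Module.finrank F W :=
      Submodule.finrank_lt_finrank_of_lt (inf_lt_left.2 hstab)
    omega
  obtain ⟨v, hv, hgen⟩ := finrank_eq_one_iff'.1 hle
  refine ⟨v, by simpa using hv, v.2.1, (hmem v).1 v.2.2, fun w hw haw => ?_⟩
  obtain ⟨f, hf⟩ := hgen ⟨w, hw, (hmem w).2 haw⟩
  exact ⟨f, congrArg Subtype.val hf⟩

/-- Singer's theorem: a finite field `F` with `q` elements gives rise to a perfect difference set in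
a cyclic group of order `q ^ 2 + q + 1`. -/
theorem exists_perfect_difference_set (F K : Type) [Field F] [Field K] [Finite K] [Algebra F K]
    (h : Module.finrank F K = 3) :
    ∃ (A : Type) (_ : CommGroup A) (S : Set A), IsCyclic A ∧
      Nat.card A = Nat.card F ^ 2 + Nat.card F + 1 ∧
      IsPerfectDifferenceSet S := by
  have : Module.Finite F K := Module.finite_of_finrank_pos (by omega)
  have : Finite F := Finite.of_injective _ (algebraMap F K).injective
  obtain ⟨W, hW⟩ := exists_submodule_finrank_eq_two h
  let φ : Fˣ →* Kˣ := Units.map (algebraMap F K).toMonoidHom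
  have hφ : ∀ f, ((φ f : Kˣ) : K) = algebraMap F K f := fun f => rfl
  let mk : Kˣ →* Kˣ ⧸ φ.range := QuotientGroup.mk' φ.range
  have hmk : ∀ x y, mk x = mk y ↔ ∃ f, x * φ f = y := fun x y => by
    rw [QuotientGroup.mk'_eq_mk']
    simp
  refine ⟨Kˣ ⧸ φ.range, inferInstance, {x | ∃ u : Kˣ, (u : K) ∈ W ∧ mk u = x},
    isCyclic_of_surjective mk (QuotientGroup.mk'_surjective _), ?_, ?_⟩
  · have hinj : Function.Injective φ := Units.map_injective (algebraMap F K).injective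
    have h1 := Subgroup.card_eq_card_quotient_mul_card_subgroup φ.range
    rw [← Nat.card_congr (MonoidHom.ofInjective hinj).toEquiv, Nat.card_units, Nat.card_units,
      Module.natCard_eq_pow_finrank (K := F), h] at h1
    have hF : 1 < Nat.card F := Finite.one_lt_card
    obtain ⟨r, hr⟩ : ∃ r, Nat.card F = r + 2 := ⟨Nat.card F - 2, by omega⟩
    rw [hr] at h1 ⊢
    refine Nat.eq_of_mul_eq_mul_right (Nat.succ_pos r) (h1.symm.trans ?_)
    rw [Nat.sub_eq_iff_eq_add (Nat.one_le_pow _ _ (by omega)), Nat.succ_eq_add_one]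
    ring
  · intro α hα
    obtain ⟨a, rfl⟩ := QuotientGroup.mk'_surjective _ α
    change mk a ≠ 1 at hα
    have ha : ∀ f : F, algebraMap F K f ≠ a := by
      intro f hf
      have hf0 : f ≠ 0 := by
        rintro rfl
        simp [eq_comm] at hf
      refine hα (((hmk 1 a).2 ⟨Units.mk0 f hf0, ?_⟩).symm.trans (map_one mk))
      ext
      simpa [hφ] using hf
    obtain ⟨v, hv0, hv, hav, hgen⟩ := exists_generator_inter_translate h hW ha
    refine ⟨(mk (a * Units.mk0 v hv0), mk (Units.mk0 v hv0)),
      ⟨⟨_, hav, rfl⟩, ⟨_, hv, rfl⟩, by simp [mk]⟩, ?_⟩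
    rintro ⟨_, _⟩ ⟨⟨u, hu, rfl⟩, ⟨w, hw, rfl⟩, huw⟩
    change mk u / mk w = mk a at huw
    rw [div_eq_iff_eq_mul, ← map_mul] at huw
    obtain ⟨f, hf⟩ := (hmk _ _).1 huw
    obtain ⟨g, hg⟩ := hgen w hw (by
      have := congrArg Units.val hf
      rw [Units.val_mul, Units.val_mul, hφ, mul_comm, ← Algebra.smul_def] at this
      rw [← this]
      exact W.smul_mem _ hu)
    have hg0 : g ≠ 0 := by
      rintro rfl
      exact w.ne_zero (by rw [← hg, zero_smul])
    have hwv : mk w = mk (Units.mk0 v hv0) := by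
      refine ((hmk _ _).2 ⟨Units.mk0 g hg0, ?_⟩).symm
      ext
      rw [Units.val_mul, hφ, ← hg, Algebra.smul_def, mul_comm]
      rfl
    simp [huw, hwv]

/-- The translates of a perfect difference set, with the cosets of a subgroup as classes. -/
theorem IsPerfectDifferenceSet.exists_design {P : Type*} [CommGroup P] [Fintype P] [DecidableEq P]
    {S : Finset P} (hS : IsPerfectDifferenceSet (S : Set P)) (L : Subgroup P) {c d m n : ℕ}
    (hc : Nat.card L = c) (hd : L.index = d) (hcn : c = 2 * n + 1) (hdm : d = 2 * m + 1) :
    ∃ (k lam : ℕ) (ℬ : Finset (Finset P)) (G : Subgroup (Equiv.Perm P)) (𝒞 : Finset (Finset P)),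
      0 < lam ∧
      (∀ B ∈ ℬ, B.card = k) ∧
      (∀ p : Finset (P), p.card = 2 → (ℬ.filter fun B => p ⊆ B).card = lam) ∧
      (∀ g ∈ G, ∀ B ∈ ℬ, B.image ⇑g ∈ ℬ) ∧
      (∀ B₁ ∈ ℬ, ∀ B₂ ∈ ℬ, ∃ g ∈ G, B₁.image ⇑g = B₂) ∧
      𝒞.card = d ∧ (∀ C ∈ 𝒞, C.card = c) ∧
      (∀ x : P, ∃! C, C ∈ 𝒞 ∧ x ∈ C) ∧
      (∀ g ∈ G, ∀ C ∈ 𝒞, C.image ⇑g ∈ 𝒞) ∧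
      (∀ B ∈ ℬ, innerPairs 𝒞 B = n) ∧
      (∀ B ∈ ℬ, outerPairs 𝒞 B = m * c) ∧
      (∀ C ∈ 𝒞, ∀ H : Subgroup (Equiv.Perm {x // x ∈ C}),
        (∀ h : Equiv.Perm {x // x ∈ C},
          h ∈ H ↔ ∃ g ∈ G, ∀ x : {x // x ∈ C}, (↑(h x) : P) = g ↑x) →
        permRank H = 2 * n + 1) ∧
      (∀ K : Subgroup (Equiv.Perm {D // D ∈ 𝒞}),
        (∀ κ : Equiv.Perm {D // D ∈ 𝒞},
          κ ∈ K ↔ ∃ g ∈ G, ∀ D : {D // D ∈ 𝒞},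
            (↑(κ D) : Finset (P)) = (↑D : Finset (P)).image ⇑g) →
        permRank K = 2 * m + 1) := by
  have himg : ∀ g a : P, (S.image (a * ·)).image ⇑(MulAction.toPermHom P P g)
      = S.image (g * a * ·) := by
    intro g a
    rw [image_image]
    simp only [Function.comp_def, MulAction.toPermHom_apply, MulAction.toPerm_apply, smul_eq_mul,
      mul_assoc]
  refine ⟨S.card, 1, univ.image fun a : P => S.image (a * ·), (MulAction.toPermHom P P).range,
    univ.image (cosetFinset L), one_pos, ?_, fun p hp => hS.card_translates_containing hp,
    ?_, ?_, ?_, ?_, ?_, ?_, ?_, ?_, ?_, ?_⟩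
  · simp only [mem_image, mem_univ, true_and, forall_exists_index, forall_apply_eq_imp_iff]
    exact fun a => card_image_of_injective _ (mul_right_injective a)
  · rintro _ ⟨g, rfl⟩ B hB
    obtain ⟨a, -, rfl⟩ := mem_image.1 hB
    rw [himg]
    exact mem_image.2 ⟨g * a, mem_univ _, rfl⟩
  · intro B₁ hB₁ B₂ hB₂
    obtain ⟨a, -, rfl⟩ := mem_image.1 hB₁
    obtain ⟨b, -, rfl⟩ := mem_image.1 hB₂
    exact ⟨_, ⟨b / a, rfl⟩, by rw [himg, div_mul_cancel]⟩
  · rw [card_image_cosetFinset, hd]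
  · intro C hC
    obtain ⟨a, -, rfl⟩ := mem_image.1 hC
    rw [card_cosetFinset, hc]
  · intro x
    refine ⟨cosetFinset L x, ⟨mem_image_of_mem _ (mem_univ _), ?_⟩, ?_⟩
    · simp [mem_cosetFinset, L.one_mem]
    · rintro C ⟨hC, hx⟩
      obtain ⟨a, -, rfl⟩ := mem_image.1 hC
      exact (cosetFinset_eq_iff.2 (mem_cosetFinset.1 hx)).symm
  · rintro _ ⟨g, rfl⟩ C hC
    obtain ⟨a, -, rfl⟩ := mem_image.1 hC
    exact mem_image.2 ⟨g * a, mem_univ _, (image_mul_cosetFinset L g a).symm⟩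
  · intro B hB
    obtain ⟨a, -, rfl⟩ := mem_image.1 hB
    exact hS.innerPairs_eq L (hc.trans hcn) a
  · intro B hB
    obtain ⟨a, -, rfl⟩ := mem_image.1 hB
    rw [hS.outerPairs_eq L (hd.trans hdm) a, hc]
  · intro C hC
    obtain ⟨a, -, rfl⟩ := mem_image.1 hC
    intro H hH
    rw [permRank_coset L a H hH, hc, hcn]
  · intro K hK
    rw [permRank_cosets L K hK, hd, hdm]

theorem IsPerfectDifferenceSet.exists_transport {A P : Type*} [CommGroup A] [IsCyclic A] [Finite P]
    {S : Set A} (hS : IsPerfectDifferenceSet S) (e : A ≃ P) {c d : ℕ} (hc : 0 < c)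
    (hcard : Nat.card A = c * d) :
    ∃ (_ : CommGroup P) (T : Finset P) (L : Subgroup P),
      IsPerfectDifferenceSet (T : Set P) ∧ Nat.card L = c ∧ L.index = d := by
  let _ : CommGroup P := e.symm.commGroup
  let f : A ≃* P := e.symm.mulEquiv.symm
  have : Finite A := Finite.of_equiv _ e.symm
  have hd : 0 < d := pos_of_mul_pos_right (hcard ▸ Nat.card_pos) hc.le
  obtain ⟨g, hg⟩ := IsCyclic.exists_ofOrder_eq_natCard (α := A)
  have hL : Nat.card (Subgroup.zpowers (f g ^ d)) = c := by
    rw [Nat.card_zpowers, orderOf_pow, f.orderOf_eq, hg, hcard, Nat.gcd_mul_left_left,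
      Nat.mul_div_cancel _ hd]
  refine ⟨inferInstance, (Set.toFinite (f '' S)).toFinset, Subgroup.zpowers (f g ^ d), ?_, hL, ?_⟩
  · rw [Set.Finite.coe_toFinset]
    exact hS.image f
  · have := (Subgroup.zpowers (f g ^ d)).card_mul_index
    rw [hL, ← Nat.card_congr e, hcard] at this
    exact Nat.eq_of_mul_eq_mul_left hc this

/-- For every `N > 0` there is a block-transitive, point-imprimitive `2`-design whose
Delandtsheer–Doyen parameters satisfy `m, n > N` and whose induced groups attain the
maximal ranks `Rank(H) = 2n + 1` and `Rank(K) = 2m + 1`. -/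
theorem exists_design_with_large_dd_parameters_and_max_rank (N : ℕ) (hN : 0 < N) :
    ∃ (c d k lam m n : ℕ) (ℬ : Finset (Finset (Fin (c * d))))
      (G : Subgroup (Equiv.Perm (Fin (c * d)))) (𝒞 : Finset (Finset (Fin (c * d)))),
      2 ≤ c ∧ 2 ≤ d ∧ 0 < lam ∧
      (∀ B ∈ ℬ, B.card = k) ∧
      (∀ p : Finset (Fin (c * d)), p.card = 2 → (ℬ.filter fun B => p ⊆ B).card = lam) ∧
      (∀ g ∈ G, ∀ B ∈ ℬ, B.image ⇑g ∈ ℬ) ∧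
      (∀ B₁ ∈ ℬ, ∀ B₂ ∈ ℬ, ∃ g ∈ G, B₁.image ⇑g = B₂) ∧
      𝒞.card = d ∧ (∀ C ∈ 𝒞, C.card = c) ∧
      (∀ x : Fin (c * d), ∃! C, C ∈ 𝒞 ∧ x ∈ C) ∧
      (∀ g ∈ G, ∀ C ∈ 𝒞, C.image ⇑g ∈ 𝒞) ∧
      0 < m ∧ 0 < n ∧
      (∀ B ∈ ℬ, innerPairs 𝒞 B = n) ∧
      (∀ B ∈ ℬ, outerPairs 𝒞 B = m * c) ∧
      N < m ∧ N < n ∧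
      (∀ C ∈ 𝒞, ∀ H : Subgroup (Equiv.Perm {x // x ∈ C}),
        (∀ h : Equiv.Perm {x // x ∈ C},
          h ∈ H ↔ ∃ g ∈ G, ∀ x : {x // x ∈ C}, (↑(h x) : Fin (c * d)) = g ↑x) →
        permRank H = 2 * n + 1) ∧
      (∀ K : Subgroup (Equiv.Perm {D // D ∈ 𝒞}),
        (∀ κ : Equiv.Perm {D // D ∈ 𝒞},
          κ ∈ K ↔ ∃ g ∈ G, ∀ D : {D // D ∈ 𝒞},
            (↑(κ D) : Finset (Fin (c * d))) = (↑D : Finset (Fin (c * d))).image ⇑g) →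
        permRank K = 2 * m + 1) := by
  obtain ⟨p, hpN, hp⟩ := Nat.exists_infinite_primes (N + 3)
  have : Fact p.Prime := ⟨hp⟩
  obtain ⟨r, rfl⟩ : ∃ r, p = r + 1 := ⟨p - 1, by omega⟩
  obtain ⟨n, hn⟩ : ∃ n, (r + 1) * (r + 2) = n + n := Nat.even_mul_succ_self (r + 1)
  obtain ⟨m, hm⟩ : ∃ m, r * (r + 1) = m + m := Nat.even_mul_succ_self r
  have hNm : N < m := by nlinarith
  have hmn : m < n := by nlinarith
  let F := GaloisField (r + 1) 2
  let K := FiniteField.Extension F (r + 1) 3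
  obtain ⟨A, hA, S, hcyc, hcard, hS⟩ := exists_perfect_difference_set F K
    (FiniteField.finrank_extension F (r + 1) 3)
  rw [GaloisField.card _ _ two_ne_zero] at hcard
  have hAcd : Nat.card A = (2 * n + 1) * (2 * m + 1) := by
    rw [hcard, two_mul, two_mul, ← hn, ← hm]
    ring
  have : Finite A := Nat.finite_of_card_ne_zero (by rw [hAcd]; positivity)
  let e : A ≃ Fin ((2 * n + 1) * (2 * m + 1)) := Finite.equivFinOfCardEq hAcd
  obtain ⟨_, T, L, hT, hL, hL'⟩ := hS.exists_transport e (by omega) hAcd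
  obtain ⟨k, lam, ℬ, G, 𝒞, h1, h2, h3, h4, h5, h6, h7, h8, h9, h10, h11, h12⟩ :=
    hT.exists_design L hL hL' rfl rfl
  exact ⟨2 * n + 1, 2 * m + 1, k, lam, m, n, ℬ, G, 𝒞, by omega, by omega, h1, h2, h3, h4, h5, h6,
    h7, h8, h9, by omega, by omega, h10, h11, hNm, hNm.trans hmn, h12⟩
end

section
/- Suppose [n,c] is a useful pair with c + n = k(k−1)/2 (k an integer with k ≥ 2n), and let d = 1 + (c−1)/n. Then there exist λ and a 2-(cd, k, λ) design 𝒟 admitting a block-transitive group G of automorphisms leaving invariant a partition 𝒞 of the point set into d classes each of size c, with Delandtsheer–Doyen parameters (m,n) = (1,n) (every block contains exactly n inner pairs and exactly c outer pairs), such that the induced group H = G_C^C on a class satisfies Rank(H) = PairRank(H) + 1 = n + 1 and the induced group K = G^𝒞 on 𝒞 satisfies Rank(K) = PairRank(K) + 1 = 2. -/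
open Finset

/-! ### Automorphisms of a coloured complete digraph -/

/-- The group of permutations preserving a colouring of the ordered pairs of points. -/
def colorAut {P κ : Type*} (col : P → P → κ) : Subgroup (Equiv.Perm P) where
  carrier := {g | ∀ x y, col (g x) (g y) = col x y}
  mul_mem' := by
    intro a b ha hb x y
    simpa [hb x y] using ha (b x) (b y)
  one_mem' := by intro x y; rfl
  inv_mem' := by
    intro a ha x y
    simpa using (ha (a⁻¹ x) (a⁻¹ y)).symm

/-- The colour classes are orbits of the colour-preserving permutations. -/
def ColorTransitive {P κ : Type*} (col : P → P → κ) : Prop :=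
  ∀ x y z w, col x y = col z w → ∃ g ∈ colorAut col, g x = z ∧ g y = w

/-- The number of ordered pairs of elements of `B` of colour `t`. -/
def colorCount {P κ : Type*} [DecidableEq κ] (col : P → P → κ) (B : Finset P) (t : κ) : ℕ :=
  ((B ×ˢ B).filter fun p => col p.1 p.2 = t).card

open Classical in
/-- The orbit of `B` under the colour-preserving permutations. -/
noncomputable def colorOrbit {P κ : Type*} [Fintype P] (col : P → P → κ) (B : Finset P) :
    Finset (Finset P) :=
  univ.filter fun B' => ∃ g ∈ colorAut col, B.image ⇑g = B'

section Orbit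

variable {P κ : Type*} [DecidableEq P] {col : P → P → κ}

lemma colorCount_image [DecidableEq κ] {g : Equiv.Perm P} (hg : g ∈ colorAut col) (B : Finset P)
    (t : κ) : colorCount col (B.image ⇑g) t = colorCount col B t := by
  symm
  refine card_bij (fun p _ => (g p.1, g p.2)) ?_ ?_ ?_
  · rintro ⟨x, y⟩ h
    simp only [mem_filter, mem_product] at h ⊢
    exact ⟨⟨mem_image_of_mem _ h.1.1, mem_image_of_mem _ h.1.2⟩, (hg x y).trans h.2⟩
  · rintro ⟨x, y⟩ _ ⟨x', y'⟩ _ h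
    simpa using h
  · rintro ⟨x, y⟩ h
    simp only [mem_filter, mem_product, mem_image] at h
    obtain ⟨⟨⟨a, ha, rfl⟩, ⟨b, hb, rfl⟩⟩, h⟩ := h
    exact ⟨(a, b), by simp [ha, hb, ← h, hg a b], rfl⟩

variable [Fintype P]

lemma mem_colorOrbit {B B' : Finset P} :
    B' ∈ colorOrbit col B ↔ ∃ g ∈ colorAut col, B.image ⇑g = B' := by
  simp only [colorOrbit, mem_filter, mem_univ, true_and]
  refine exists_congr fun g => and_congr_right fun _ => ?_
  constructor <;> intro h <;> rw [← h] <;> ext <;> simp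

lemma self_mem_colorOrbit (B : Finset P) : B ∈ colorOrbit col B :=
  mem_colorOrbit.2 ⟨1, one_mem _, by simp⟩

lemma image_mem_colorOrbit {B B' : Finset P} {g : Equiv.Perm P} (hg : g ∈ colorAut col)
    (h : B' ∈ colorOrbit col B) : B'.image ⇑g ∈ colorOrbit col B := by
  obtain ⟨a, ha, rfl⟩ := mem_colorOrbit.1 h
  exact mem_colorOrbit.2 ⟨g * a, mul_mem hg ha, by simp [image_image]⟩

lemma exists_image_eq_of_mem_colorOrbit {B B₁ B₂ : Finset P} (h₁ : B₁ ∈ colorOrbit col B)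
    (h₂ : B₂ ∈ colorOrbit col B) : ∃ g ∈ colorAut col, B₁.image ⇑g = B₂ := by
  obtain ⟨a, ha, rfl⟩ := mem_colorOrbit.1 h₁
  obtain ⟨b, hb, rfl⟩ := mem_colorOrbit.1 h₂
  refine ⟨b * a⁻¹, mul_mem hb (inv_mem ha), ?_⟩
  rw [image_image]
  congr 1
  ext x
  simp

lemma card_filter_mem_eq_of_col_eq (hcol : ColorTransitive col) (B : Finset P) {x y x' y' : P}
    (h : col x y = col x' y') :
    ((colorOrbit col B).filter fun B' => x ∈ B' ∧ y ∈ B').card =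
      ((colorOrbit col B).filter fun B' => x' ∈ B' ∧ y' ∈ B').card := by
  obtain ⟨g, hg, rfl, rfl⟩ := hcol _ _ _ _ h
  refine card_bij (fun B' _ => B'.image ⇑g) ?_ ?_ ?_
  · intro B' h
    simp only [mem_filter] at h ⊢
    exact ⟨image_mem_colorOrbit hg h.1, mem_image_of_mem _ h.2.1, mem_image_of_mem _ h.2.2⟩
  · intro B₁ _ B₂ _ h
    exact image_injective g.injective h
  · intro B' h
    simp only [mem_filter] at h
    refine ⟨B'.image ⇑g⁻¹, ?_, ?_⟩
    · simp only [mem_filter]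
      refine ⟨image_mem_colorOrbit (inv_mem hg) h.1, ?_, ?_⟩
      · exact mem_image.2 ⟨_, h.2.1, by simp⟩
      · exact mem_image.2 ⟨_, h.2.2, by simp⟩
    · ext z; simp

/-- If the colour distribution of `B` is proportional to that of the whole space, then every pair
of points lies in the same number of images of `B`. -/
lemma mul_card_filter_mem_eq [DecidableEq κ] (hcol : ColorTransitive col) (B : Finset P) (s : ℕ)
    {x y : P} (h : colorCount col univ (col x y) = s * colorCount col B (col x y)) :
    s * ((colorOrbit col B).filter fun B' => x ∈ B' ∧ y ∈ B').card = (colorOrbit col B).card := by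
  set t := col x y with ht
  have hpos : 0 < colorCount col B t := by
    have : 0 < colorCount col univ t := card_pos.2 ⟨(x, y), by simp [ht]⟩
    rw [h] at this
    exact Nat.pos_of_mul_pos_left this
  have key := sum_card_bipartiteAbove_eq_sum_card_bipartiteBelow
    (s := (univ ×ˢ univ : Finset (P × P)).filter fun p => col p.1 p.2 = t)
    (t := colorOrbit col B) (fun p B' => p.1 ∈ B' ∧ p.2 ∈ B')
  have above : ∀ p ∈ (univ ×ˢ univ : Finset (P × P)).filter fun p => col p.1 p.2 = t,
      (bipartiteAbove (fun p B' => p.1 ∈ B' ∧ p.2 ∈ B') (colorOrbit col B) p).card =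
        ((colorOrbit col B).filter fun B' => x ∈ B' ∧ y ∈ B').card := by
    rintro ⟨a, b⟩ hp
    simp only [mem_filter] at hp
    exact card_filter_mem_eq_of_col_eq hcol B (hp.2.trans ht)
  have below : ∀ B' ∈ colorOrbit col B,
      (bipartiteBelow (fun p B' => p.1 ∈ B' ∧ p.2 ∈ B')
        ((univ ×ˢ univ : Finset (P × P)).filter fun p => col p.1 p.2 = t) B').card =
        colorCount col B t := by
    intro B' hB'
    obtain ⟨g, hg, rfl⟩ := mem_colorOrbit.1 hB'
    rw [← colorCount_image hg, colorCount, bipartiteBelow, filter_filter]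
    congr 1
    ext p
    simp [and_comm]
  rw [sum_congr rfl above, sum_congr rfl below, sum_const, sum_const, smul_eq_mul,
    smul_eq_mul, ← colorCount, h] at key
  refine Nat.eq_of_mul_eq_mul_right hpos ?_
  linarith

end Orbit

/-! ### Ranks of groups whose orbits are colour classes -/

lemma permRank_eq_card_range {Ω T : Type*} {X : Subgroup (Equiv.Perm Ω)} (col : Ω → Ω → T)
    (h : ∀ x y x' y', (∃ g ∈ X, g x = x' ∧ g y = y') ↔ col x y = col x' y') :
    permRank X = Nat.card {t | ∃ x y, col x y = t} := by
  have hO : ∀ p : Ω × Ω, {q | ∃ g ∈ X, (g p.1, g p.2) = q} =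
      {q | col p.1 p.2 = col q.1 q.2} := by
    intro p
    ext q
    simp only [Set.mem_ofPred_eq, ← h, Prod.ext_iff]
  symm
  refine Nat.card_eq_of_bijective
    (fun t => ⟨{q | t.1 = col q.1 q.2}, ?_⟩) ⟨?_, ?_⟩
  · obtain ⟨t, x, y, rfl⟩ := t
    exact ⟨(x, y), (hO (x, y)).symm⟩
  · rintro ⟨_, x, y, rfl⟩ ⟨_, x', y', rfl⟩ hs
    have hs' : {q : Ω × Ω | col x y = col q.1 q.2} = {q | col x' y' = col q.1 q.2} :=
      congrArg Subtype.val hs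
    have : (x, y) ∈ {q : Ω × Ω | col x' y' = col q.1 q.2} := by
      rw [← hs']; rfl
    exact Subtype.ext (Eq.symm this)
  · rintro ⟨_, p, rfl⟩
    exact ⟨⟨col p.1 p.2, p.1, p.2, rfl⟩, Subtype.ext (hO p).symm⟩

lemma permPairRank_eq_card_range {Ω T : Type*} [DecidableEq Ω] {X : Subgroup (Equiv.Perm Ω)}
    (col : Ω → Ω → T) (hsymm : ∀ x y, col x y = col y x)
    (h : ∀ x y x' y', (∃ g ∈ X, g x = x' ∧ g y = y') ↔ col x y = col x' y') :
    permPairRank X = Nat.card {t | ∃ x y, x ≠ y ∧ col x y = t} := by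
  have hO : ∀ x y, x ≠ y → {t | ∃ g ∈ X, ({x, y} : Finset Ω).image ⇑g = t} =
      {s | ∃ x' y', s = {x', y'} ∧ col x y = col x' y'} := by
    intro x y _
    ext s
    constructor
    · rintro ⟨g, hg, rfl⟩
      exact ⟨g x, g y, by simp [image_insert], (h ..).1 ⟨g, hg, rfl, rfl⟩⟩
    · rintro ⟨x', y', rfl, hc⟩
      obtain ⟨g, hg, rfl, rfl⟩ := (h ..).2 hc
      exact ⟨g, hg, by simp [image_insert]⟩
  symm
  refine Nat.card_eq_of_bijective
    (fun t => ⟨{s | ∃ x' y', s = {x', y'} ∧ t.1 = col x' y'}, ?_⟩) ⟨?_, ?_⟩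
  · obtain ⟨t, x, y, hxy, rfl⟩ := t
    exact ⟨{x, y}, card_pair hxy, (hO x y hxy).symm⟩
  · rintro ⟨_, x, y, hxy, rfl⟩ ⟨_, x', y', hxy', rfl⟩ hs
    have hs' : {s : Finset Ω | ∃ a b, s = {a, b} ∧ col x y = col a b} =
        {s | ∃ a b, s = {a, b} ∧ col x' y' = col a b} := congrArg Subtype.val hs
    have : ({x, y} : Finset Ω) ∈
        {s : Finset Ω | ∃ a b, s = {a, b} ∧ col x' y' = col a b} := by
      rw [← hs']; exact ⟨x, y, rfl, rfl⟩
    obtain ⟨a, b, hab, hc⟩ := this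
    apply Subtype.ext
    change col x y = col x' y'
    rw [hc]
    have hab' : s(x, y) = s(a, b) := by
      have := congrArg (fun s : Finset Ω => (s : Set Ω)) hab
      simp only [coe_insert, coe_singleton] at this
      rcases Set.pair_eq_pair_iff.1 this with ⟨rfl, rfl⟩ | ⟨rfl, rfl⟩
      · rfl
      · exact Sym2.eq_swap
    rcases Sym2.eq_iff.1 hab' with ⟨rfl, rfl⟩ | ⟨rfl, rfl⟩
    · rfl
    · exact hsymm _ _
  · rintro ⟨_, s, hs, rfl⟩
    obtain ⟨x, y, hxy, rfl⟩ := card_eq_two.1 hs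
    exact ⟨⟨col x y, x, y, hxy, rfl⟩, Subtype.ext (hO x y hxy).symm⟩

/-! ### Power residues in a finite field -/

/-- In a field of order `n * m + 1` the nonzero `m`-th powers have exactly `n` values, each of
them attained `m` times. -/
lemma exists_pow_representatives {F : Type*} [Field F] [Fintype F] [DecidableEq F] {n m : ℕ}
    (hn : 0 < n) (hm : 0 < m) (hF : Fintype.card F = n * m + 1) :
    ∃ u : Fin n → F, (∀ i, u i ≠ 0) ∧ (Function.Injective fun i => u i ^ m) ∧
      (∀ z : F, z ≠ 0 → ∃ i, z ^ m = u i ^ m) ∧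
      ∀ i, (univ.filter fun z : F => z ^ m = u i ^ m).card = m := by
  obtain ⟨g, hg⟩ := IsCyclic.exists_generator (α := Fˣ)
  have hord : orderOf g = n * m := by
    rw [orderOf_eq_card_of_forall_mem_zpowers hg, Nat.card_eq_fintype_card, Fintype.card_units, hF]
    simp
  have hprim : IsPrimitiveRoot (g : F) (n * m) := by
    rw [← hord, IsPrimitiveRoot.coe_units_iff]
    exact IsPrimitiveRoot.orderOf g
  refine ⟨fun i => (g : F) ^ (i : ℕ), fun i => pow_ne_zero _ g.ne_zero, ?_, ?_, ?_⟩
  · intro i j hij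
    simp only [← pow_mul] at hij
    have := hprim.pow_inj (Nat.mul_lt_mul_of_pos_right i.2 hm)
      (Nat.mul_lt_mul_of_pos_right j.2 hm) hij
    exact Fin.ext (Nat.eq_of_mul_eq_mul_right hm this)
  · intro z hz
    obtain ⟨a, ha⟩ := (mem_powers_iff_mem_zpowers).2 (hg (Units.mk0 z hz))
    refine ⟨⟨a % n, Nat.mod_lt _ hn⟩, ?_⟩
    have hz' : z = (g : F) ^ a := by
      simpa using (congrArg Units.val ha).symm
    have h1 : (g : F) ^ (n * m) = 1 := hprim.pow_eq_one
    calc z ^ m = (g : F) ^ ((a % n + n * (a / n)) * m) := by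
          rw [hz', ← pow_mul, Nat.mod_add_div]
      _ = (g : F) ^ (a % n * m) * ((g : F) ^ (n * m)) ^ (a / n) := by ring
      _ = _ := by rw [h1, one_pow, mul_one, pow_mul]
  · intro i
    have hm' : IsPrimitiveRoot ((g : F) ^ n) m := hprim.pow (Nat.mul_pos hn hm) rfl
    have hcard := hm'.card_nthRoots (((g : F) ^ (i : ℕ)) ^ m)
    rw [if_pos ⟨_, rfl⟩] at hcard
    refine Eq.trans ?_ hcard
    rw [← Multiset.toFinset_card_of_nodup
      (hm'.nthRoots_nodup (pow_ne_zero _ (pow_ne_zero _ g.ne_zero)))]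
    congr 1
    ext z
    simp [Polynomial.mem_nthRoots hm]

/-! ### Partitions detected by a colouring -/

/-- `𝒞` is a partition into nonempty classes, and the pairs of colour `none` are those that meet
two classes. -/
structure IsClassColoring {P κ : Type*} (col : P → P → Option κ) (𝒞 : Finset (Finset P)) :
    Prop where
  nonempty : ∀ C ∈ 𝒞, C.Nonempty
  existsUnique : ∀ x, ∃! C, C ∈ 𝒞 ∧ x ∈ C
  inner_iff : ∀ x y, (∃ C ∈ 𝒞, x ∈ C ∧ y ∈ C) ↔ col x y ≠ none

namespace IsClassColoring

variable {P κ : Type*} {col : P → P → Option κ} {𝒞 : Finset (Finset P)}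

lemma mem_iff (h : IsClassColoring col 𝒞) {C : Finset P} (hC : C ∈ 𝒞) {x y : P} (hx : x ∈ C) :
    y ∈ C ↔ col x y ≠ none := by
  rw [← h.inner_iff]
  refine ⟨fun hy => ⟨C, hC, hx, hy⟩, ?_⟩
  rintro ⟨D, hD, hxD, hy⟩
  rwa [(h.existsUnique x).unique ⟨hC, hx⟩ ⟨hD, hxD⟩]

/-- The group induced on a class has the colour classes as orbits on ordered pairs. -/
lemma induced_orbit_iff (h : IsClassColoring col 𝒞) (hcol : ColorTransitive col)
    {C : Finset P} (hC : C ∈ 𝒞) {H : Subgroup (Equiv.Perm {x // x ∈ C})}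
    (hH : ∀ f : Equiv.Perm {x // x ∈ C},
      f ∈ H ↔ ∃ g ∈ colorAut col, ∀ x : {x // x ∈ C}, (↑(f x) : P) = g ↑x)
    (x y x' y' : {x // x ∈ C}) :
    (∃ f ∈ H, f x = x' ∧ f y = y') ↔ col x y = col x' y' := by
  constructor
  · rintro ⟨f, hf, rfl, rfl⟩
    obtain ⟨g, hg, hfg⟩ := (hH f).1 hf
    rw [hfg, hfg, hg]
  · intro hxy
    obtain ⟨g, hg, hx, hy⟩ := hcol _ _ _ _ hxy
    have hgC : ∀ z, g z ∈ C ↔ z ∈ C := by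
      intro z
      rw [h.mem_iff hC x'.2, h.mem_iff hC x.2, ← hx, hg]
    refine ⟨g.subtypePerm hgC, (hH _).2 ⟨g, hg, fun _ => rfl⟩, Subtype.ext hx, Subtype.ext hy⟩

variable [DecidableEq P]

lemma image_eq (h : IsClassColoring col 𝒞) {g : Equiv.Perm P} (hg : g ∈ colorAut col)
    {C D : Finset P} (hC : C ∈ 𝒞) (hD : D ∈ 𝒞) {x : P} (hx : x ∈ C) (hgx : g x ∈ D) :
    C.image ⇑g = D := by
  ext y
  rw [mem_image]
  constructor
  · rintro ⟨z, hz, rfl⟩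
    rw [h.mem_iff hD hgx, hg]
    exact (h.mem_iff hC hx).1 hz
  · intro hy
    refine ⟨g⁻¹ y, ?_, by simp⟩
    rw [h.mem_iff hC hx, ← hg]
    simpa using (h.mem_iff hD hgx).1 hy

lemma image_mem (h : IsClassColoring col 𝒞) {g : Equiv.Perm P} (hg : g ∈ colorAut col)
    {C : Finset P} (hC : C ∈ 𝒞) : C.image ⇑g ∈ 𝒞 := by
  obtain ⟨x, hx⟩ := h.nonempty C hC
  obtain ⟨D, ⟨hD, hgx⟩, -⟩ := h.existsUnique (g x)
  rwa [h.image_eq hg hC hD hx hgx]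

/-- The group induced on the set of classes is doubly transitive. -/
lemma quotient_orbit_iff (h : IsClassColoring col 𝒞) (hcol : ColorTransitive col)
    (hdiag : ∀ x y, col x x = col y y)
    {K : Subgroup (Equiv.Perm {D // D ∈ 𝒞})}
    (hK : ∀ κ : Equiv.Perm {D // D ∈ 𝒞}, κ ∈ K ↔ ∃ g ∈ colorAut col, ∀ D : {D // D ∈ 𝒞},
      (↑(κ D) : Finset P) = (↑D : Finset P).image ⇑g)
    (x y x' y' : {D // D ∈ 𝒞}) :
    (∃ f ∈ K, f x = x' ∧ f y = y') ↔ decide (x = y) = decide (x' = y') := by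
  have hind : ∀ g ∈ colorAut col, ∃ f ∈ K, ∀ D : {D // D ∈ 𝒞},
      (↑(f D) : Finset P) = (↑D : Finset P).image ⇑g := by
    intro g hg
    let f : Equiv.Perm {D // D ∈ 𝒞} :=
      { toFun := fun D => ⟨D.1.image ⇑g, h.image_mem hg D.2⟩
        invFun := fun D => ⟨D.1.image ⇑g⁻¹, h.image_mem (inv_mem hg) D.2⟩
        left_inv := fun D => Subtype.ext (by ext; simp)
        right_inv := fun D => Subtype.ext (by ext; simp) }
    exact ⟨f, (hK f).2 ⟨g, hg, fun _ => rfl⟩, fun _ => rfl⟩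
  constructor
  · rintro ⟨f, -, rfl, rfl⟩
    simp
  · intro hxy
    rw [decide_eq_decide] at hxy
    obtain ⟨p, hp⟩ := h.nonempty _ x.2
    obtain ⟨q, hq⟩ := h.nonempty _ y.2
    obtain ⟨p', hp'⟩ := h.nonempty _ x'.2
    obtain ⟨q', hq'⟩ := h.nonempty _ y'.2
    by_cases he : x = y
    · obtain ⟨g, hg, hgp, -⟩ := hcol _ _ _ _ (hdiag p p')
      obtain ⟨f, hf, hfg⟩ := hind g hg
      have hx : f x = x' := Subtype.ext <|
        (hfg x).trans (h.image_eq hg x.2 x'.2 hp (hgp ▸ hp'))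
      exact ⟨f, hf, hx, by rw [← he, hx, hxy.1 he]⟩
    · have outer : ∀ {a b : {D // D ∈ 𝒞}} {r t : P}, r ∈ a.1 → t ∈ b.1 → a ≠ b →
          col r t = none := by
        intro a b r t hr ht hab
        by_contra hne
        exact hab (Subtype.ext ((h.existsUnique t).unique
          ⟨a.2, (h.mem_iff a.2 hr).2 hne⟩ ⟨b.2, ht⟩))
      obtain ⟨g, hg, hgp, hgq⟩ := hcol p q p' q' <| by
        rw [outer hp hq he, outer hp' hq' (mt hxy.2 he)]
      obtain ⟨f, hf, hfg⟩ := hind g hg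
      exact ⟨f, hf,
        Subtype.ext <| (hfg x).trans (h.image_eq hg x.2 x'.2 hp (hgp ▸ hp')),
        Subtype.ext <| (hfg y).trans (h.image_eq hg y.2 y'.2 hq (hgq ▸ hq'))⟩

lemma permRank_quotient (h : IsClassColoring col 𝒞) (hcol : ColorTransitive col)
    (hdiag : ∀ x y, col x x = col y y) (h𝒞 : 1 < 𝒞.card)
    {K : Subgroup (Equiv.Perm {D // D ∈ 𝒞})}
    (hK : ∀ κ : Equiv.Perm {D // D ∈ 𝒞}, κ ∈ K ↔ ∃ g ∈ colorAut col, ∀ D : {D // D ∈ 𝒞},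
      (↑(κ D) : Finset P) = (↑D : Finset P).image ⇑g) :
    permRank K = 2 ∧ permPairRank K = 1 := by
  obtain ⟨C, hC, D, hD, hCD⟩ := one_lt_card.1 h𝒞
  have hne : (⟨C, hC⟩ : {D // D ∈ 𝒞}) ≠ ⟨D, hD⟩ := fun e => hCD (congrArg Subtype.val e)
  rw [permRank_eq_card_range _ (h.quotient_orbit_iff hcol hdiag hK),
    permPairRank_eq_card_range _ (fun x y => by simp only [eq_comm])
      (h.quotient_orbit_iff hcol hdiag hK)]
  constructor
  · have : {t | ∃ x y : {D // D ∈ 𝒞}, decide (x = y) = t} = Set.univ := by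
      refine Set.eq_univ_of_forall fun t => ?_
      cases t
      · exact ⟨_, _, decide_eq_false hne⟩
      · exact ⟨⟨C, hC⟩, _, decide_eq_true rfl⟩
    rw [this]
    simp
  · have : {t | ∃ x y : {D // D ∈ 𝒞}, x ≠ y ∧ decide (x = y) = t} = {false} := by
      ext t
      constructor
      · rintro ⟨x, y, hxy, rfl⟩
        exact decide_eq_false hxy
      · rintro rfl
        exact ⟨_, _, hne, decide_eq_false hne⟩
    rw [this]
    simp

end IsClassColoring

lemma IsClassColoring.permRank_induced {P : Type*} [DecidableEq P] {n : ℕ}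
    {col : P → P → Option (Option (Fin n))} {𝒞 : Finset (Finset P)}
    (h : IsClassColoring col 𝒞) (hcol : ColorTransitive col)
    (hsymm : ∀ x y, col x y = col y x) (hdiag : ∀ x y, col x y = some none ↔ x = y)
    (hex : ∀ x i, ∃ y, col x y = some (some i))
    {C : Finset P} (hC : C ∈ 𝒞) {H : Subgroup (Equiv.Perm {x // x ∈ C})}
    (hH : ∀ f : Equiv.Perm {x // x ∈ C},
      f ∈ H ↔ ∃ g ∈ colorAut col, ∀ x : {x // x ∈ C}, (↑(f x) : P) = g ↑x) :
    permRank H = n + 1 ∧ permPairRank H = n := by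
  rw [permRank_eq_card_range (fun x y : {x // x ∈ C} => col x y) (h.induced_orbit_iff hcol hC hH),
    permPairRank_eq_card_range (fun x y : {x // x ∈ C} => col x y) (fun x y => hsymm x y)
      (h.induced_orbit_iff hcol hC hH)]
  obtain ⟨x, hx⟩ := h.nonempty C hC
  have hin : ∀ i, ∃ y, ∃ hy : y ∈ C, x ≠ y ∧ col x y = some (some i) := by
    intro i
    obtain ⟨y, hy⟩ := hex x i
    refine ⟨y, (h.mem_iff hC hx).2 (by simp [hy]), ?_, hy⟩
    intro e
    rw [(hdiag x y).2 e] at hy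
    simp at hy
  constructor
  · have : {t | ∃ x y : {x // x ∈ C}, col x y = t} = Set.range some := by
      ext t
      constructor
      · rintro ⟨a, b, rfl⟩
        obtain ⟨s, hs⟩ := Option.ne_none_iff_exists'.1 ((h.mem_iff hC a.2).1 b.2)
        exact ⟨s, hs.symm⟩
      · rintro ⟨_ | i, rfl⟩
        · exact ⟨⟨x, hx⟩, ⟨x, hx⟩, (hdiag x x).2 rfl⟩
        · obtain ⟨y, hy, -, hi⟩ := hin i
          exact ⟨⟨x, hx⟩, ⟨y, hy⟩, hi⟩
    rw [this, Nat.card_range_of_injective (Option.some_injective _)]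
    simp
  · have : {t | ∃ x y : {x // x ∈ C}, x ≠ y ∧ col x y = t} =
        Set.range ((some : Option (Fin n) → _) ∘ some) := by
      ext t
      constructor
      · rintro ⟨a, b, hab, rfl⟩
        obtain ⟨_ | i, hs⟩ := Option.ne_none_iff_exists'.1 ((h.mem_iff hC a.2).1 b.2)
        · exact absurd (Subtype.ext ((hdiag _ _).1 hs)) hab
        · exact ⟨i, hs.symm⟩
      · rintro ⟨i, rfl⟩
        obtain ⟨y, hy, hne, hi⟩ := hin i
        exact ⟨⟨x, hx⟩, ⟨y, hy⟩, fun e => hne (congrArg Subtype.val e), hi⟩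
    rw [this, Nat.card_range_of_injective
      ((Option.some_injective _).comp (Option.some_injective _))]
    simp

/-! ### Counting pairs by colour -/

/-- Ordered pairs of distinct elements come in twos over the unordered ones. -/
lemma card_filter_offDiag_eq_two_mul {P : Type*} [DecidableEq P] (B : Finset P)
    (R : P → P → Prop) [∀ x y, Decidable (R x y)] (S : Finset P → Prop) [DecidablePred S]
    (hRS : ∀ x y, S {x, y} ↔ R x y) :
    (B.offDiag.filter fun p => R p.1 p.2).card = 2 * ((B.powersetCard 2).filter S).card := by
  rw [card_eq_sum_card_fiberwise (f := fun p : P × P => ({p.1, p.2} : Finset P))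
    (t := (B.powersetCard 2).filter S), sum_const_nat (m := 2), mul_comm]
  · intro s hs
    rw [mem_filter, mem_powersetCard] at hs
    obtain ⟨⟨hsB, hs2⟩, hS⟩ := hs
    obtain ⟨x, y, hxy, rfl⟩ := card_eq_two.1 hs2
    have hx : x ∈ B := hsB (by simp)
    have hy : y ∈ B := hsB (by simp)
    have hne : ((x, y) : P × P) ≠ (y, x) := fun e => hxy (congrArg Prod.fst e)
    rw [← card_pair hne]
    congr 1
    ext ⟨a, b⟩
    simp only [mem_filter, mem_offDiag, mem_insert, mem_singleton, Prod.mk.injEq]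
    constructor
    · rintro ⟨⟨⟨-, -, hab⟩, -⟩, e⟩
      have ha : a ∈ ({x, y} : Finset P) := e ▸ by simp
      have hb : b ∈ ({x, y} : Finset P) := e ▸ by simp
      simp only [mem_insert, mem_singleton] at ha hb
      grind
    · rintro (⟨rfl, rfl⟩ | ⟨rfl, rfl⟩)
      · exact ⟨⟨⟨hx, hy, hxy⟩, (hRS _ _).1 hS⟩, rfl⟩
      · exact ⟨⟨⟨hy, hx, hxy.symm⟩, (hRS _ _).1 (pair_comm a b ▸ hS)⟩, pair_comm _ _⟩
  · rintro ⟨x, y⟩ hp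
    simp only [coe_filter, mem_offDiag, Set.mem_ofPred_eq] at hp
    simp only [coe_filter, Set.mem_ofPred_eq, mem_powersetCard]
    exact ⟨⟨by simp [insert_subset_iff, hp.1.1, hp.1.2.1], card_pair hp.1.2.2⟩,
      (hRS x y).2 hp.2⟩

lemma colorCount_univ {P κ : Type*} [Fintype P] [DecidableEq κ] {col : P → P → κ} {t : κ} {v : ℕ}
    (h : ∀ x, (univ.filter fun y => col x y = t).card = v) :
    colorCount col univ t = Fintype.card P * v := by
  rw [colorCount, card_filter, sum_product, ← card_univ, ← smul_eq_mul, ← sum_const]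
  refine sum_congr rfl fun x _ => ?_
  rw [← card_filter, h x]

namespace IsClassColoring

lemma two_mul_outerPairs {P κ : Type*} [DecidableEq P] [DecidableEq κ] {col : P → P → Option κ}
    {𝒞 : Finset (Finset P)} (h : IsClassColoring col 𝒞) (hdiag : ∀ x, col x x ≠ none)
    (B : Finset P) : 2 * outerPairs 𝒞 B = colorCount col B none := by
  rw [outerPairs, ← card_filter_offDiag_eq_two_mul B (fun x y => col x y = none), colorCount]
  · congr 1
    ext ⟨x, y⟩
    simp only [mem_filter, mem_offDiag, mem_product]
    constructor
    · tauto
    · rintro ⟨⟨hx, hy⟩, hxy⟩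
      exact ⟨⟨hx, hy, by rintro rfl; exact hdiag x hxy⟩, hxy⟩
  · intro x y
    rw [← not_iff_not, not_not, ← ne_eq, ← h.inner_iff]
    simp [insert_subset_iff]

lemma two_mul_innerPairs {P : Type*} [DecidableEq P] {n : ℕ}
    {col : P → P → Option (Option (Fin n))} {𝒞 : Finset (Finset P)} (h : IsClassColoring col 𝒞)
    (hdiag : ∀ x y, col x y = some none ↔ x = y) (B : Finset P) :
    2 * innerPairs 𝒞 B = ∑ i, colorCount col B (some (some i)) := by
  rw [innerPairs, ← card_filter_offDiag_eq_two_mul B (fun x y => col x y ≠ none)]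
  · rw [card_eq_sum_card_fiberwise (f := fun p : P × P => col p.1 p.2)
      (t := univ.image fun i => some (some i)), sum_image]
    · refine sum_congr rfl fun i _ => ?_
      rw [colorCount]
      congr 1
      ext ⟨x, y⟩
      simp only [mem_filter, mem_offDiag, mem_product]
      constructor
      · tauto
      · rintro ⟨⟨hx, hy⟩, hxy⟩
        refine ⟨⟨⟨hx, hy, fun e => ?_⟩, by simp [hxy]⟩, hxy⟩
        rw [(hdiag x y).2 e] at hxy
        simp at hxy
    · intro i _ j _ hij
      simpa using hij
    · rintro ⟨x, y⟩ hp
      simp only [coe_filter, mem_offDiag, Set.mem_ofPred_eq] at hp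
      obtain ⟨_ | i, hs⟩ := Option.ne_none_iff_exists'.1 hp.2
      · exact absurd ((hdiag _ _).1 hs) hp.1.2.2
      · simp [hs]
  · intro x y
    rw [← h.inner_iff]
    simp [insert_subset_iff]

end IsClassColoring

lemma innerPairs_add_outerPairs {P : Type*} [DecidableEq P] (𝒞 : Finset (Finset P))
    (B : Finset P) : innerPairs 𝒞 B + outerPairs 𝒞 B = B.card.choose 2 := by
  rw [innerPairs, outerPairs, card_filter_add_card_filter_not, card_powersetCard]

/-! ### The affine model -/

/-- The cosets of the group of `m`-th roots of unity can be indexed by `Fin n` when the field has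
order `n * m + 1`. -/
lemma exists_residue_index {F : Type*} [Field F] [Fintype F] [DecidableEq F] {n m : ℕ}
    (hn : 0 < n) (hm : 0 < m) (hF : Fintype.card F = n * m + 1) :
    ∃ idx : F → Option (Fin n), (∀ z, idx z = none ↔ z = 0) ∧
      (∀ z w, idx z = idx w ↔ z ^ m = w ^ m) ∧
      ∀ i, (univ.filter fun z => idx z = some i).card = m := by
  obtain ⟨u, hu0, hinj, hex, hcard⟩ := exists_pow_representatives hn hm hF
  choose f hf using hex
  let idx : F → Option (Fin n) := fun z => if h : z = 0 then none else some (f z h)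
  have hidx0 : ∀ z, idx z = none ↔ z = 0 := by
    intro z
    by_cases h : z = 0 <;> simp [idx, h]
  have hidx : ∀ z i, idx z = some i ↔ z ^ m = u i ^ m := by
    intro z i
    by_cases h : z = 0
    · simp only [idx, h, dif_pos, zero_pow hm.ne', reduceCtorEq, false_iff]
      exact (pow_ne_zero _ (hu0 i)).symm
    · simp only [idx, h, dif_neg, not_false_eq_true, Option.some.injEq, hf z h]
      exact hinj.eq_iff.symm
  refine ⟨idx, hidx0, fun z w => ?_, fun i => ?_⟩
  · rcases hw : idx w with _ | i
    · rw [hidx0, (hidx0 w).1 hw, zero_pow hm.ne', pow_eq_zero_iff hm.ne']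
    · rw [hidx, (hidx w i).1 hw]
  · simp only [hidx]
    exact hcard i

/-- Pairs in different copies of `F` get colour `none`; pairs in the same copy are coloured by the
index of their difference. -/
def affineColor {F ι κ : Type*} [Sub F] [DecidableEq ι] (idx : F → κ) (p q : F × ι) : Option κ :=
  if p.2 = q.2 then some (idx (p.1 - q.1)) else none

section Affine

variable {F ι κ : Type*} [Field F] [DecidableEq ι] {idx : F → κ} {m : ℕ}

lemma affineColor_ne_none {p q : F × ι} : affineColor idx p q ≠ none ↔ p.2 = q.2 := by
  simp [affineColor]

lemma affineColor_symm (hidx : ∀ z w, idx z = idx w ↔ z ^ m = w ^ m) (hm : Even m)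
    (p q : F × ι) : affineColor idx p q = affineColor idx q p := by
  have h : idx (p.1 - q.1) = idx (q.1 - p.1) := by
    rw [hidx, ← neg_sub, hm.neg_pow]
  simp only [affineColor, eq_comm (a := p.2), h]

/-- Affine maps with linear part an `m`-th root of unity, acting on each copy of `F` with its own
translation part and permuting the copies, preserve the colouring. -/
lemma exists_affine_mem_colorAut (hidx : ∀ z w, idx z = idx w ↔ z ^ m = w ^ m) {a : F}
    (ha : a ≠ 0) (ham : a ^ m = 1) (t : ι → F) (σ : Equiv.Perm ι) :
    ∃ g ∈ colorAut (affineColor (ι := ι) idx), ∀ p : F × ι, g p = (a * p.1 + t p.2, σ p.2) := by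
  refine ⟨{ toFun := fun p => (a * p.1 + t p.2, σ p.2)
            invFun := fun p => (a⁻¹ * (p.1 - t (σ.symm p.2)), σ.symm p.2)
            left_inv := fun p => by simp [ha]
            right_inv := fun p => by simp [ha] }, ?_, fun _ => rfl⟩
  intro p q
  by_cases h : p.2 = q.2
  · have h' : a * p.1 + t q.2 - (a * q.1 + t q.2) = a * (p.1 - q.1) := by ring
    simp [affineColor, h, h', hidx, mul_pow, ham]
  · simp [affineColor, h]

lemma colorTransitive_affineColor (hidx : ∀ z w, idx z = idx w ↔ z ^ m = w ^ m) (hm : 0 < m) :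
    ColorTransitive (affineColor (ι := ι) idx) := by
  rintro ⟨x, i⟩ ⟨y, j⟩ ⟨x', i'⟩ ⟨y', j'⟩ h
  by_cases hij : i = j
  · subst hij
    have hij' : i' = j' := by
      by_contra hne
      simp [affineColor, hne] at h
    subst hij'
    have hpow : (x - y) ^ m = (x' - y') ^ m := by
      simpa [affineColor, hidx] using h
    obtain ⟨a, ha, ham, hxy⟩ : ∃ a : F, a ≠ 0 ∧ a ^ m = 1 ∧ a * (x - y) = x' - y' := by
      by_cases h0 : x - y = 0
      · rw [h0, zero_pow hm.ne', eq_comm, pow_eq_zero_iff hm.ne'] at hpow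
        exact ⟨1, one_ne_zero, one_pow _, by rw [h0, hpow, mul_zero]⟩
      · have h0' : x' - y' ≠ 0 := by
          intro e
          rw [e, zero_pow hm.ne', pow_eq_zero_iff hm.ne'] at hpow
          exact h0 hpow
        refine ⟨(x' - y') / (x - y), div_ne_zero h0' h0, ?_, div_mul_cancel₀ _ h0⟩
        rw [div_pow, hpow, div_self (pow_ne_zero _ h0')]
    obtain ⟨g, hg, hgp⟩ := exists_affine_mem_colorAut hidx ha ham (fun _ => x' - a * x)
      (Equiv.swap i i')
    refine ⟨g, hg, ?_, ?_⟩
    · simp [hgp]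
    · rw [hgp]
      ext
      · dsimp only
        linear_combination -hxy
      · simp
  · have hij' : i' ≠ j' := by
      rintro rfl
      simp [affineColor, hij] at h
    have hσ : ∃ σ : Equiv.Perm ι, σ i = i' ∧ σ j = j' := by
      refine ⟨Equiv.swap (Equiv.swap i i' j) j' * Equiv.swap i i', ?_, by simp⟩
      rw [Equiv.Perm.mul_apply, Equiv.swap_apply_left]
      refine Equiv.swap_apply_of_ne_of_ne (fun e => hij ?_) hij'
      rw [← (Equiv.swap i i').injective.eq_iff, Equiv.swap_apply_left, ← e]
    obtain ⟨σ, hi, hj⟩ := hσ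
    obtain ⟨g, hg, hgp⟩ := exists_affine_mem_colorAut hidx one_ne_zero (one_pow _)
      (fun l => if l = i then x' - x else y' - y) σ
    exact ⟨g, hg, by simp [hgp, hi], by simp [hgp, hj, Ne.symm hij]⟩

lemma card_filter_affineColor_eq_some [Fintype F] [Fintype ι] [DecidableEq κ]
    (t : κ) (p : F × ι) :
    (univ.filter fun q => affineColor idx p q = some t).card =
      (univ.filter fun z => idx z = t).card := by
  refine card_bij' (fun q _ => p.1 - q.1) (fun z _ => (p.1 - z, p.2)) ?_ ?_ ?_ ?_
  · intro q hq
    rw [mem_filter] at hq ⊢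
    have hpq : p.2 = q.2 := affineColor_ne_none.1 (by rw [hq.2]; simp)
    simpa [affineColor, hpq] using hq.2
  · intro z hz
    simpa [affineColor] using hz
  · intro q hq
    rw [mem_filter] at hq
    have hpq : p.2 = q.2 := affineColor_ne_none.1 (by rw [hq.2]; simp)
    ext <;> simp [hpq]
  · intro z _
    simp

lemma card_filter_affineColor_eq_none [Fintype F] [Fintype ι] [DecidableEq κ] (p : F × ι) :
    (univ.filter fun q => affineColor idx p q = none).card =
      Fintype.card F * (Fintype.card ι - 1) := by
  have : (univ.filter fun q => affineColor idx p q = none) =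
      (univ : Finset F) ×ˢ (univ.erase p.2) := by
    ext q
    rw [mem_filter, ← not_iff_not]
    simp only [mem_univ, true_and, ← ne_eq, affineColor_ne_none]
    simp [eq_comm]
  rw [this, card_product, card_erase_of_mem (mem_univ _), card_univ, card_univ]

end Affine

/-- A `k`-set meeting `n` copies of `F` in a pair of points, one pair of each colour, and `k - 2n`
further copies in a single point. -/
lemma exists_base_block {F : Type*} [Field F] [DecidableEq F] {n m k d : ℕ}
    {idx : F → Option (Fin n)} (hidx0 : ∀ z, idx z = none ↔ z = 0)
    (hidx : ∀ z w, idx z = idx w ↔ z ^ m = w ^ m) (hm : Even m)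
    (hex : ∀ i, ∃ z, idx z = some i) (hk : 2 * n ≤ k) (hkd : k - n ≤ d) :
    ∃ B : Finset (F × Fin d), B.card = k ∧
      ∀ i, colorCount (affineColor idx) B (some (some i)) = 2 := by
  choose u hu using hex
  have hu0 : ∀ i, u i ≠ 0 := fun i e => by
    have := (hidx0 (u i)).2 e
    rw [hu] at this
    simp at this
  have hneg : ∀ z, idx (-z) = idx z := fun z => by rw [hidx, hm.neg_pow]
  have hnd : n ≤ d := by omega
  let a : Fin (k - n) → F × Fin d := fun j => (0, Fin.castLE hkd j)
  let b : Fin n → F × Fin d := fun i => (u i, Fin.castLE hnd i)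
  have ha : Function.Injective a := fun i j h => by simpa [a] using h
  have hb : Function.Injective b := fun i j h => by
    have := congrArg Prod.snd h
    simpa [b] using this
  have hmem : ∀ p, p ∈ univ.image a ∪ univ.image b ↔
      (p.1 = 0 ∧ (p.2 : ℕ) < k - n) ∨ ∃ i : Fin n, p.1 = u i ∧ (p.2 : ℕ) = i := by
    rintro ⟨x, j⟩
    simp only [mem_union, mem_image, mem_univ, true_and, a, b, Prod.mk.injEq]
    refine or_congr ⟨?_, ?_⟩ (exists_congr fun i => ?_)
    · rintro ⟨l, rfl, rfl⟩
      exact ⟨rfl, l.2⟩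
    · rintro ⟨rfl, h⟩
      exact ⟨⟨j, h⟩, rfl, rfl⟩
    · simp only [Fin.ext_iff, Fin.val_castLE, eq_comm]
  refine ⟨univ.image a ∪ univ.image b, ?_, fun i => ?_⟩
  · rw [card_union_of_disjoint, card_image_of_injective _ ha, card_image_of_injective _ hb,
      card_univ, card_univ, Fintype.card_fin, Fintype.card_fin]
    · omega
    · rw [disjoint_left]
      intro p hp hp'
      obtain ⟨j, -, rfl⟩ := mem_image.1 hp
      obtain ⟨i, -, h⟩ := mem_image.1 hp'
      exact hu0 i (congrArg Prod.fst h)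
  · have hne : (((0, Fin.castLE hnd i), b i) : (F × Fin d) × (F × Fin d)) ≠
        (b i, (0, Fin.castLE hnd i)) := fun e => hu0 i (congrArg (fun q => q.1.1) e).symm
    rw [colorCount, ← card_pair hne]
    congr 1
    ext ⟨⟨x, j⟩, ⟨y, l⟩⟩
    rw [mem_filter, mem_product, hmem, hmem]
    simp only [mem_insert, mem_singleton, Prod.mk.injEq, b, affineColor]
    constructor
    · rintro ⟨⟨hp, hq⟩, hc⟩
      have hjl : j = l := by
        by_contra hne
        simp [hne] at hc
      subst hjl
      simp only [if_true, Option.some.injEq] at hc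
      rcases hp with ⟨rfl, -⟩ | ⟨s, rfl, hs⟩ <;> rcases hq with ⟨rfl, -⟩ | ⟨s', rfl, hs'⟩
      · rw [sub_zero, (hidx0 0).2 rfl] at hc
        simp at hc
      · rw [zero_sub, hneg, hu, Option.some.injEq] at hc
        subst hc
        have : j = Fin.castLE hnd s' := Fin.ext hs'
        simp [this]
      · rw [sub_zero, hu, Option.some.injEq] at hc
        subst hc
        have : j = Fin.castLE hnd s := Fin.ext hs
        simp [this]
      · have : s = s' := Fin.ext (hs.symm.trans hs')
        rw [this, sub_self, (hidx0 0).2 rfl] at hc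
        simp at hc
    · have hi := i.2
      rintro (⟨⟨rfl, rfl⟩, ⟨rfl, rfl⟩⟩ | ⟨⟨rfl, rfl⟩, ⟨rfl, rfl⟩⟩)
      · exact ⟨⟨Or.inl ⟨rfl, by simp; omega⟩, Or.inr ⟨i, rfl, rfl⟩⟩, by simp [hneg, hu]⟩
      · exact ⟨⟨Or.inr ⟨i, rfl, rfl⟩, Or.inl ⟨rfl, by simp; omega⟩⟩, by simp [hu]⟩

/-! ### Transport along a bijection -/

section Transport

variable {P Q κ : Type*} {col : Q → Q → κ}

lemma ColorTransitive.comp_equiv (h : ColorTransitive col) (e : P ≃ Q) :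
    ColorTransitive fun x y => col (e x) (e y) := by
  intro x y x' y' hxy
  obtain ⟨g, hg, hx, hy⟩ := h _ _ _ _ hxy
  refine ⟨e.symm.permCongr g, fun a b => ?_, ?_, ?_⟩
  · simpa [Equiv.permCongr_apply] using hg (e a) (e b)
  · simp [Equiv.permCongr_apply, hx]
  · simp [Equiv.permCongr_apply, hy]

lemma colorCount_map_symm [DecidableEq κ] (e : P ≃ Q) (B : Finset Q) (t : κ) :
    colorCount (fun x y => col (e x) (e y)) (B.map e.symm.toEmbedding) t =
      colorCount col B t := by
  refine card_bij' (fun p _ => (e p.1, e p.2)) (fun q _ => (e.symm q.1, e.symm q.2)) ?_ ?_ ?_ ?_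
  · rintro ⟨x, y⟩ h
    simpa [mem_map_equiv] using h
  · rintro ⟨x, y⟩ h
    simpa [mem_map_equiv] using h
  · simp
  · simp

lemma card_filter_comp_equiv [Fintype P] [Fintype Q] (e : P ≃ Q) (p : Q → Prop)
    [DecidablePred p] : (univ.filter fun x => p (e x)).card = (univ.filter p).card := by
  refine card_bij' (fun x _ => e x) (fun y _ => e.symm y) ?_ ?_ ?_ ?_ <;> simp

end Transport

/-! ### The main theorem -/

/-- **Theorem 1.9.** If `[n, c]` is a useful pair with `c + n = C(k,2)` and
`d = 1 + (c−1)/n`, then there is a block-transitive, point-imprimitive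
`2`-(cd, k, λ) design with Delandtsheer–Doyen parameters `(1, n)` such that
`Rank(H) = PairRank(H) + 1 = n + 1` and `Rank(K) = PairRank(K) + 1 = 2`. -/
theorem useful_pair_design_exists
    (n c k d : ℕ) (hn : 2 ≤ n) (hc : IsPrimePow c) (hmod : c % (2 * n) = 1)
    (hck : c + n = Nat.choose k 2) (hk : 2 * n ≤ k) (hd : d = 1 + (c - 1) / n) :
    ∃ (lam : ℕ) (ℬ : Finset (Finset (Fin (c * d))))
      (G : Subgroup (Equiv.Perm (Fin (c * d)))) (𝒞 : Finset (Finset (Fin (c * d)))),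
      0 < lam ∧
      (∀ B ∈ ℬ, B.card = k) ∧
      (∀ p : Finset (Fin (c * d)), p.card = 2 → (ℬ.filter fun B => p ⊆ B).card = lam) ∧
      (∀ g ∈ G, ∀ B ∈ ℬ, B.image ⇑g ∈ ℬ) ∧
      (∀ B₁ ∈ ℬ, ∀ B₂ ∈ ℬ, ∃ g ∈ G, B₁.image ⇑g = B₂) ∧
      𝒞.card = d ∧ (∀ C ∈ 𝒞, C.card = c) ∧
      (∀ x : Fin (c * d), ∃! C, C ∈ 𝒞 ∧ x ∈ C) ∧
      (∀ g ∈ G, ∀ C ∈ 𝒞, C.image ⇑g ∈ 𝒞) ∧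
      (∀ B ∈ ℬ, innerPairs 𝒞 B = n) ∧
      (∀ B ∈ ℬ, outerPairs 𝒞 B = 1 * c) ∧
      (∀ C ∈ 𝒞, ∀ H : Subgroup (Equiv.Perm {x // x ∈ C}),
        (∀ h : Equiv.Perm {x // x ∈ C},
          h ∈ H ↔ ∃ g ∈ G, ∀ x : {x // x ∈ C}, (↑(h x) : Fin (c * d)) = g ↑x) →
        permRank H = n + 1 ∧ permPairRank H = n) ∧
      (∀ K : Subgroup (Equiv.Perm {D // D ∈ 𝒞}),
        (∀ κ : Equiv.Perm {D // D ∈ 𝒞},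
          κ ∈ K ↔ ∃ g ∈ G, ∀ D : {D // D ∈ 𝒞},
            (↑(κ D) : Finset (Fin (c * d))) = (↑D : Finset (Fin (c * d))).image ⇑g) →
        permRank K = 2 ∧ permPairRank K = 1) := by
  obtain ⟨r, hr⟩ : ∃ r, c = n * (2 * r) + 1 :=
    ⟨c / (2 * n), by linarith [Nat.mod_add_div c (2 * n)]⟩
  have hr0 : 0 < r := by
    rcases Nat.eq_zero_or_pos r with rfl | h
    · exact absurd hr (by simpa using hc.one_lt.ne')
    · exact h
  have hm : Even (2 * r) := even_two_mul r
  have hdr : d = 1 + 2 * r := by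
    rw [hd, hr, Nat.add_sub_cancel, Nat.mul_div_cancel_left _ (by omega)]
  have hkd : k - n ≤ d := by
    have hk2 : k * (k - 1) = 2 * (c + n) := by
      rw [hck, Nat.choose_two_right, Nat.mul_div_cancel' (Nat.even_mul_pred_self k).two_dvd]
    obtain ⟨a, rfl⟩ := Nat.exists_eq_add_of_le hk
    obtain ⟨l, hl⟩ : ∃ l, 2 * n + a = l + 1 := ⟨2 * n + a - 1, by omega⟩
    by_contra hlt
    have hle : 2 * r + 2 ≤ n + a := by omega
    rw [hl, Nat.add_sub_cancel, hr] at hk2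
    have := Nat.mul_le_mul_left (2 * n) hle
    nlinarith [Nat.le_mul_self a]
  obtain ⟨p, e, hp, he, hpe⟩ := (isPrimePow_nat_iff c).1 hc
  have : Fact p.Prime := ⟨hp⟩
  let F := GaloisField p e
  let _ : Fintype F := Fintype.ofFinite F
  let _ : DecidableEq F := Classical.decEq F
  have hF : Fintype.card F = c := by
    rw [← Nat.card_eq_fintype_card, GaloisField.card p e he.ne', hpe]
  obtain ⟨idx, hidx0, hidx, hidxcard⟩ :=
    exists_residue_index (F := F) (n := n) (m := 2 * r) (by omega) (by omega) (hF.trans hr)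
  have hidxex : ∀ i, ∃ z, idx z = some i := fun i => by
    obtain ⟨z, hz⟩ := card_pos.1 (lt_of_lt_of_eq (by omega : 0 < 2 * r) (hidxcard i).symm)
    exact ⟨z, by simpa using hz⟩
  obtain ⟨B₀, hB₀, hB₀col⟩ := exists_base_block (d := d) hidx0 hidx hm hidxex hk hkd
  have φ : Fin (c * d) ≃ F × Fin d := Fintype.equivOfCardEq (by simp [hF])
  set col : Fin (c * d) → Fin (c * d) → Option (Option (Fin n)) :=
    fun x y => affineColor idx (φ x) (φ y) with hcoldef
  have hcol : ColorTransitive col :=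
    (colorTransitive_affineColor hidx (by omega)).comp_equiv φ
  have hsymm : ∀ x y, col x y = col y x := fun x y => affineColor_symm hidx hm _ _
  have hdiag : ∀ x y, col x y = some none ↔ x = y := by
    intro x y
    rw [← φ.injective.eq_iff, Prod.ext_iff]
    by_cases h : (φ x).2 = (φ y).2 <;> simp [hcoldef, affineColor, h, hidx0, sub_eq_zero]
  have hval : ∀ x i, (univ.filter fun y => col x y = some (some i)).card = 2 * r := fun x i =>
    (card_filter_comp_equiv φ _).trans
      ((card_filter_affineColor_eq_some _ _).trans (hidxcard i))
  have hval' : ∀ x, (univ.filter fun y => col x y = none).card = c * (2 * r) := fun x => by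
    refine (card_filter_comp_equiv φ _).trans ((card_filter_affineColor_eq_none _).trans ?_)
    rw [hF, Fintype.card_fin, hdr, Nat.add_sub_cancel_left]
  have hex : ∀ x i, ∃ y, col x y = some (some i) := fun x i => by
    obtain ⟨y, hy⟩ := card_pos.1 (lt_of_lt_of_eq (by omega : 0 < 2 * r) (hval x i).symm)
    exact ⟨y, by simpa using hy⟩
  let cls : Fin d → Finset (Fin (c * d)) := fun j => univ.filter fun x => (φ x).2 = j
  have hcls : ∀ j, (cls j).card = c := fun j => by
    refine (card_filter_comp_equiv φ fun q => q.2 = j).trans ?_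
    have : (univ.filter fun q : F × Fin d => q.2 = j) = univ ×ˢ {j} := by
      ext q
      rw [mem_filter, mem_product, mem_singleton]
      simp
    rw [this, card_product, card_univ, hF, card_singleton, mul_one]
  have hclsne : ∀ j, (cls j).Nonempty := fun j =>
    card_pos.1 (by rw [hcls]; exact hc.pos)
  have hclsinj : Function.Injective cls := fun i j hij => by
    obtain ⟨x, hx⟩ := hclsne i
    have hx' : x ∈ cls j := hij ▸ hx
    simp only [cls, mem_filter, mem_univ, true_and] at hx hx'
    exact hx.symm.trans hx'
  set 𝒞 : Finset (Finset (Fin (c * d))) := univ.image cls with h𝒞def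
  have h𝒞card : 𝒞.card = d := by
    rw [h𝒞def, card_image_of_injective _ hclsinj, card_univ, Fintype.card_fin]
  have h𝒞 : IsClassColoring col 𝒞 := by
    refine ⟨?_, fun x => ⟨cls (φ x).2, by simp [h𝒞def, cls], ?_⟩, fun x y => ?_⟩
    · simpa [h𝒞def] using hclsne
    · rintro D ⟨hD, hx⟩
      obtain ⟨j, -, rfl⟩ := mem_image.1 hD
      simp only [cls, mem_filter, mem_univ, true_and] at hx
      rw [hx]
    · rw [hcoldef, affineColor_ne_none]
      simp [h𝒞def, cls, eq_comm]
  set B := B₀.map φ.symm.toEmbedding with hBdef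
  have hBcard : ∀ B' ∈ colorOrbit col B, B'.card = k := fun B' hB' => by
    obtain ⟨g, -, rfl⟩ := mem_colorOrbit.1 hB'
    rw [card_image_of_injective _ g.injective, hBdef, card_map, hB₀]
  have hBcol : ∀ B' ∈ colorOrbit col B, ∀ i, colorCount col B' (some (some i)) = 2 :=
    fun B' hB' i => by
      obtain ⟨g, hg, rfl⟩ := mem_colorOrbit.1 hB'
      rw [colorCount_image hg, hBdef, colorCount_map_symm, hB₀col]
  have hinner : ∀ B' ∈ colorOrbit col B, innerPairs 𝒞 B' = n := fun B' hB' => by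
    have := h𝒞.two_mul_innerPairs hdiag B'
    rw [sum_congr rfl fun i _ => hBcol B' hB' i, sum_const, card_univ, Fintype.card_fin,
      smul_eq_mul] at this
    omega
  have houter : ∀ B' ∈ colorOrbit col B, outerPairs 𝒞 B' = c := fun B' hB' => by
    have := innerPairs_add_outerPairs 𝒞 B'
    rw [hinner B' hB', hBcard B' hB', ← hck] at this
    omega
  have hdiag' : ∀ x y, col x x = col y y := fun x y => by
    rw [(hdiag x x).2 rfl, (hdiag y y).2 rfl]
  have hBself := self_mem_colorOrbit (col := col) B
  have hprop : ∀ x y, x ≠ y →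
      colorCount col univ (col x y) = c * d * r * colorCount col B (col x y) := by
    intro x y hxy
    rcases ht : col x y with _ | _ | i
    · rw [colorCount_univ hval', ← h𝒞.two_mul_outerPairs (fun x => by simp [(hdiag x x).2 rfl]),
        houter B hBself, Fintype.card_fin]
      ring
    · exact absurd ((hdiag x y).1 ht) hxy
    · rw [colorCount_univ fun x => hval x i, hBcol B hBself, Fintype.card_fin]
      ring
  have hs : 0 < c * d * r := by
    have := hc.pos
    have : 0 < d := by omega
    positivity
  have hpair : ∀ x y, x ≠ y → c * d * r *
      ((colorOrbit col B).filter fun B' => x ∈ B' ∧ y ∈ B').card = (colorOrbit col B).card :=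
    fun x y hxy => mul_card_filter_mem_eq hcol B _ (hprop x y hxy)
  have hlam : ∀ q : Finset (Fin (c * d)), q.card = 2 →
      ((colorOrbit col B).filter fun B' => q ⊆ B').card =
        (colorOrbit col B).card / (c * d * r) := by
    intro q hq
    obtain ⟨x, y, hxy, rfl⟩ := card_eq_two.1 hq
    rw [← hpair x y hxy, Nat.mul_div_cancel_left _ hs]
    simp [insert_subset_iff]
  refine ⟨(colorOrbit col B).card / (c * d * r), colorOrbit col B, colorAut col, 𝒞, ?_, hBcard,
    hlam, fun g hg B' hB' => image_mem_colorOrbit hg hB',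
    fun B₁ h₁ B₂ h₂ => exists_image_eq_of_mem_colorOrbit h₁ h₂, h𝒞card, ?_, h𝒞.existsUnique,
    fun g hg C hC => h𝒞.image_mem hg hC, hinner, ?_, ?_, ?_⟩
  · obtain ⟨q, hqB, hq⟩ := exists_subset_card_eq
      ((by omega : 2 ≤ k).trans_eq (hBcard B hBself).symm)
    rw [← hlam q hq]
    exact card_pos.2 ⟨B, mem_filter.2 ⟨hBself, hqB⟩⟩
  · simpa [h𝒞def] using hcls
  · simpa using houter
  · exact fun C hC H hH => h𝒞.permRank_induced hcol hsymm hdiag hex hC hH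
  · exact fun K hK => h𝒞.permRank_quotient hcol hdiag' (by omega) hK
end
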